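/- Suppose that {r(g) : g ∈ Γ} ⊂ {λⁿ : n ∈ ℤ} for some 0 < λ < 1. Then r(Γ,∂Γ,ν)∖{0} is a subgroup of {λⁿ : n ∈ ℤ}. -/

import Mathlib

open Filter Topology MeasureTheory
open scoped ENNReal

namespace HarmonicBoundary

variable {Γ : Type} [Group Γ]

/-- Word length of `g` with respect to a generating set `S`. -/
noncomputable def wl (S : Set Γ) (g : Γ) : ℕ :=
  sInf {n : ℕ | ∃ w : List Γ, w.length = n ∧ (∀ x ∈ w, x ∈ S) ∧ w.prod = g}

/-- Word metric `d(x,y) = |x⁻¹y|`. -/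
noncomputable def wdist (S : Set Γ) (x y : Γ) : ℕ := wl S (x⁻¹ * y)

/-- Gromov product `(x|y)_z = (d(x,z)+d(y,z)-d(x,y))/2`. -/
noncomputable def gp (S : Set Γ) (z x y : Γ) : ℝ :=
  ((wdist S x z : ℝ) + (wdist S y z : ℝ) - (wdist S x y : ℝ)) / 2

/-- `S` is a finite symmetric generating set of `Γ`. -/
def IsGenSet (S : Set Γ) : Prop :=
  S.Finite ∧ (∀ s ∈ S, s⁻¹ ∈ S) ∧ Subgroup.closure S = ⊤

/-- `Γ` is `δ`-hyperbolic with respect to the word metric of `S`: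
`(x|y) ≥ min ((x|z), (y|z)) - δ` for all `x y z`. -/
def IsHyperbolic (S : Set Γ) (δ : ℝ) : Prop :=
  0 ≤ δ ∧ ∀ x y z : Γ, min (gp S 1 x z) (gp S 1 y z) - δ ≤ gp S 1 x y

/-- `Γ` is nonelementary: it has no cyclic subgroup of finite index. -/
def Nonelementary (Γ : Type) [Group Γ] : Prop :=
  ∀ g : Γ, (Subgroup.zpowers g).index = 0

/-- A sequence converges to infinity if `(x_i|x_j) → ∞`. -/
def ConvInf (S : Set Γ) (u : ℕ → Γ) : Prop :=
  Tendsto (fun p : ℕ × ℕ => gp S 1 (u p.1) (u p.2)) atTop atTop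

/-- Two sequences converging to infinity are equivalent if `(x_i|y_j) → ∞`. -/
def EquivSeq (S : Set Γ) (u v : ℕ → Γ) : Prop :=
  Tendsto (fun p : ℕ × ℕ => gp S 1 (u p.1) (v p.2)) atTop atTop

/-- An (abstract model of the) Gromov boundary of `Γ`: the points are exactly the
classes of sequences converging to infinity, modulo the equivalence `EquivSeq`,
together with the natural left action of `Γ`. -/
structure Boundary (Γ : Type) [Group Γ] (S : Set Γ) where
  pt : Type
  cls : (ℕ → Γ) → pt
  cls_surj : ∀ ξ : pt, ∃ u : ℕ → Γ, ConvInf S u ∧ cls u = ξ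
  cls_eq : ∀ u v : ℕ → Γ, ConvInf S u → ConvInf S v → (cls u = cls v ↔ EquivSeq S u v)
  smul : Γ → pt → pt
  smul_cls : ∀ (g : Γ) (u : ℕ → Γ), ConvInf S u → smul g (cls u) = cls fun n => g * u n

/-- Extension of the Gromov product to the boundary:
`(ξ|η) = sup liminf (x_i|y_j)` over sequences representing `ξ` and `η`,
as an extended nonnegative real. -/
noncomputable def bgp {S : Set Γ} (B : Boundary Γ S) (ξ η : B.pt) : ℝ≥0∞ :=
  ⨆ (u : {u : ℕ → Γ // ConvInf S u ∧ B.cls u = ξ})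
    (v : {v : ℕ → Γ // ConvInf S v ∧ B.cls v = η}),
    Filter.liminf (fun p : ℕ × ℕ => ENNReal.ofReal (gp S 1 (u.1 p.1) (v.1 p.2))) atTop

/-- Real-valued Gromov product on the boundary (finite for `ξ ≠ η`). -/
noncomputable def bgpR {S : Set Γ} (B : Boundary Γ S) (ξ η : B.pt) : ℝ := (bgp B ξ η).toReal

/-- The canonical topology of the Gromov boundary: a set is open iff around each of
its points it contains a basic neighbourhood `V_r(p) = {q | (q|p) > r}`. -/
def btop {S : Set Γ} (B : Boundary Γ S) : TopologicalSpace B.pt where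
  IsOpen O := ∀ p ∈ O, ∃ r : ℝ≥0∞, r ≠ ⊤ ∧ {q | r < bgp B q p} ⊆ O
  isOpen_univ := fun p _ => ⟨0, ENNReal.zero_ne_top, fun q _ => trivial⟩
  isOpen_inter := by
    intro A A' hA hA' p hp
    obtain ⟨r1, hr1, h1⟩ := hA p hp.1
    obtain ⟨r2, hr2, h2⟩ := hA' p hp.2
    refine ⟨max r1 r2, (max_lt hr1.lt_top hr2.lt_top).ne, fun q hq => ?_⟩
    have hq' : max r1 r2 < bgp B q p := hq
    exact ⟨h1 (show r1 < bgp B q p from (le_max_left r1 r2).trans_lt hq'),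
      h2 (show r2 < bgp B q p from (le_max_right r1 r2).trans_lt hq')⟩
  isOpen_sUnion := by
    intro s hs p hp
    obtain ⟨t, ht, hpt⟩ := hp
    obtain ⟨r, hr, hsub⟩ := hs t ht p hpt
    exact ⟨r, hr, fun q hq => ⟨t, ht, hsub hq⟩⟩

/-- The attracting fixed point `g⁺ = lim_n gⁿ` of an (infinite order) element. -/
def plusPt {S : Set Γ} (B : Boundary Γ S) (g : Γ) : B.pt := B.cls fun n => g ^ n

/-- The repelling fixed point `g⁻ = lim_n g⁻ⁿ` of an (infinite order) element. -/
def minusPt {S : Set Γ} (B : Boundary Γ S) (g : Γ) : B.pt := B.cls fun n => g⁻¹ ^ n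

/-- A geodesic ray starting at the identity. -/
def IsGeodesicRay (S : Set Γ) (x : ℕ → Γ) : Prop :=
  x 0 = 1 ∧ ∀ m n : ℕ, wdist S (x m) (x n) = Nat.dist m n

/-- A geodesic ray from `e` to the boundary point `ξ`, i.e. an element of `[e,ξ]`. -/
def RayTo {S : Set Γ} (B : Boundary Γ S) (x : ℕ → Γ) (ξ : B.pt) : Prop :=
  IsGeodesicRay S x ∧ ConvInf S x ∧ B.cls x = ξ

/-- A geodesic segment from `x` to `y` (parametrized on `0,…,d(x,y)`),
i.e. an element of `[x,y]`. -/
def IsGeodesicSeg (S : Set Γ) (x y : Γ) (α : ℕ → Γ) : Prop :=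
  α 0 = x ∧ α (wdist S x y) = y ∧
  ∀ m n : ℕ, m ≤ wdist S x y → n ≤ wdist S x y → wdist S (α m) (α n) = Nat.dist m n

/-- The boundary "cylinder" `U(ξ,R)`: all `η` such that for every pair of geodesic
rays `x ∈ [e,ξ]`, `y ∈ [e,η]` one has `lim_n (x(n)|y(n)) > R` (the sequence
`(x(n)|y(n))` is nondecreasing, so the limit exceeds `R` iff some term does). -/
def Uset {S : Set Γ} (B : Boundary Γ S) (ξ : B.pt) (R : ℝ) : Set B.pt :=
  {η | ∀ x y : ℕ → Γ, RayTo B x ξ → RayTo B y η → ∃ n : ℕ, R < gp S 1 (x n) (y n)}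

/-- `C_r(p) = {g | (g|e)_p > r}`. -/
def Cset (S : Set Γ) (p : Γ) (r : ℝ) : Set Γ := {g | r < gp S p g 1}

/-- The `R`-neighbourhood `N(α,R)` of a geodesic segment `α ∈ [x,y]`. -/
def segN (S : Set Γ) (x y : Γ) (α : ℕ → Γ) (R : ℝ) : Set Γ :=
  {g | ∃ i ≤ wdist S x y, (wdist S g (α i) : ℝ) ≤ R}

/-- The `R`-neighbourhood `N(A,R)` of a subset `A ⊆ Γ`. -/
def setN (S : Set Γ) (A : Set Γ) (R : ℝ) : Set Γ :=
  {g | ∃ a ∈ A, (wdist S g a : ℝ) ≤ R}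

/-- `μ` is a nondegenerate probability measure on `Γ` with support contained in `S`:
nonnegative, of total mass one, supported in `S`, and the semigroup generated by its
support is the whole of `Γ`. -/
structure IsRWMeasure (S : Set Γ) (μ : Γ → ℝ) : Prop where
  nonneg : ∀ g, 0 ≤ μ g
  support_subset : ∀ g, μ g ≠ 0 → g ∈ S
  total : ∑' g : Γ, μ g = 1
  nondeg : ∀ g : Γ, ∃ l : List Γ, l ≠ [] ∧ (∀ x ∈ l, 0 < μ x) ∧ l.prod = g

open Classical in
/-- `n`-step transition probabilities `p⁽ⁿ⁾(x,y) = μ*ⁿ(x⁻¹y)` of the random walk. -/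
noncomputable def ptrans (μ : Γ → ℝ) : ℕ → Γ → Γ → ℝ
  | 0 => fun x y => if x = y then 1 else 0
  | n + 1 => fun x y => ∑' z : Γ, ptrans μ n x z * μ (z⁻¹ * y)

/-- Green function `G(x,y) = Σ_n p⁽ⁿ⁾(x,y)`. -/
noncomputable def green (μ : Γ → ℝ) (x y : Γ) : ℝ := ∑' n : ℕ, ptrans μ n x y

/-- `F(x,y) = G(x,y)/G(y,y)`, the probability that the walk from `x` ever hits `y`. -/
noncomputable def greenF (μ : Γ → ℝ) (x y : Γ) : ℝ := green μ x y / green μ y y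

/-- The Martin kernel `K(x,y) = G(x,y)/G(e,y)`. -/
noncomputable def martinK (μ : Γ → ℝ) (x y : Γ) : ℝ := green μ x y / green μ 1 y

open Classical in
/-- Transition probabilities of the walk restricted to `Δ` (killed when leaving `Δ`). -/
noncomputable def ptransR (μ : Γ → ℝ) (Δ : Set Γ) : ℕ → Γ → Γ → ℝ
  | 0 => fun x y => if x = y ∧ x ∈ Δ then 1 else 0
  | n + 1 => fun x y => if y ∈ Δ then ∑' z : Γ, ptransR μ Δ n x z * μ (z⁻¹ * y) else 0

/-- Green function `G_Δ` of the restricted walk. -/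
noncomputable def greenR (μ : Γ → ℝ) (Δ : Set Γ) (x y : Γ) : ℝ := ∑' n : ℕ, ptransR μ Δ n x y

/-- `F_Δ(x,y) = G_Δ(x,y)/G_Δ(y,y)`. -/
noncomputable def greenFR (μ : Γ → ℝ) (Δ : Set Γ) (x y : Γ) : ℝ :=
  greenR μ Δ x y / greenR μ Δ y y

/-- Generating function `G_Δ(x,y|z) = Σ_n p_Δ⁽ⁿ⁾(x,y) zⁿ`. -/
noncomputable def greenRZ (μ : Γ → ℝ) (Δ : Set Γ) (x y : Γ) (z : ℝ) : ℝ :=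
  ∑' n : ℕ, ptransR μ Δ n x y * z ^ n

/-- Spectral radius `ρ(P) = lim_n p⁽ⁿ⁾(e,e)^{1/n}` of the walk. -/
noncomputable def specRad (μ : Γ → ℝ) : ℝ :=
  Filter.limsup (fun n : ℕ => (ptrans μ n 1 1) ^ ((n : ℝ)⁻¹)) atTop

/-- `u` is harmonic on `Λ`: `Σ_h p(g,h) u(h) = u(g)` for `g ∈ Λ`, `p(g,h)=μ(g⁻¹h)`. -/
def HarmonicOn (μ : Γ → ℝ) (u : Γ → ℝ) (Λ : Set Γ) : Prop :=
  ∀ g ∈ Λ, (∑' h : Γ, μ (g⁻¹ * h) * u h) = u g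

/-- `u` vanishes at infinity on `Λ`: `u(g_n) → 0` along sequences in `Λ` with `|g_n|→∞`. -/
def VanishesAtInftyOn (S : Set Γ) (u : Γ → ℝ) (Λ : Set Γ) : Prop :=
  ∀ ε : ℝ, 0 < ε → ∃ M : ℕ, ∀ g ∈ Λ, M ≤ wl S g → |u g| ≤ ε

open Classical in
/-- `r(g) = K(g⁻¹,g⁺)` for infinite order `g`, and `r(g) = 1` for finite order `g`;
here `Kb` is the boundary extension of the Martin kernel. -/
noncomputable def rfun {S : Set Γ} (B : Boundary Γ S) (Kb : Γ → B.pt → ℝ) (g : Γ) : ℝ :=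
  if IsOfFinOrder g then 1 else Kb g⁻¹ (plusPt B g)

/-- The ratio set `r(Γ,∂Γ,ν)`: all `l ≥ 0` such that for every `ε > 0` and every
Borel `A` of positive measure there is `g ∈ Γ` such that
`{ω ∈ gA ∩ A : |d(gν)/dν(ω) − l| < ε}` has positive measure; here the
Radon–Nikodym derivative `d(gν)/dν` is the Martin kernel `Kb g`. -/
def ratioSet {S : Set Γ} (B : Boundary Γ S) [MeasurableSpace B.pt]
    (ν : Measure B.pt) (Kb : Γ → B.pt → ℝ) : Set ℝ :=
  {l : ℝ | 0 ≤ l ∧ ∀ ε : ℝ, 0 < ε → ∀ A : Set B.pt, MeasurableSet A → 0 < ν A →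
    ∃ g : Γ, 0 < ν {ω | ω ∈ A ∧ B.smul g⁻¹ ω ∈ A ∧ |Kb g ω - l| < ε}}

/-- A left invariant finitely additive mean on `Γ`; `Γ` is amenable iff one exists. -/
structure InvariantMean (Γ : Type) [Group Γ] where
  m : Set Γ → ℝ
  nonneg : ∀ A, 0 ≤ m A
  total : m Set.univ = 1
  fin_add : ∀ A B : Set Γ, Disjoint A B → m (A ∪ B) = m A + m B
  invariant : ∀ (g : Γ) (A : Set Γ), m ((g * ·) ⁻¹' A) = m A


/-! ### Word metric -/

theorem exists_word {S : Set Γ} (hS : IsGenSet S) (g : Γ) :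
    ∃ w : List Γ, (∀ x ∈ w, x ∈ S) ∧ w.prod = g := by
  have hg : g ∈ (Subgroup.closure S).toSubmonoid := by rw [hS.2.2]; trivial
  rw [Subgroup.closure_toSubmonoid] at hg
  obtain ⟨l, hl, rfl⟩ := Submonoid.exists_list_of_mem_closure hg
  refine ⟨l, fun x hx => ?_, rfl⟩
  rcases hl x hx with h | h
  · exact h
  · simpa using hS.2.1 _ h

theorem exists_min_word {S : Set Γ} (hS : IsGenSet S) (g : Γ) :
    ∃ w : List Γ, w.length = wl S g ∧ (∀ x ∈ w, x ∈ S) ∧ w.prod = g := by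
  have hne : {n : ℕ | ∃ w : List Γ, w.length = n ∧ (∀ x ∈ w, x ∈ S) ∧ w.prod = g}.Nonempty := by
    obtain ⟨w, h1, h2⟩ := exists_word hS g
    exact ⟨w.length, w, rfl, h1, h2⟩
  exact Nat.sInf_mem hne

theorem wl_le_of_word {S : Set Γ} (w : List Γ) (h : ∀ x ∈ w, x ∈ S) :
    wl S w.prod ≤ w.length := Nat.sInf_le ⟨w, rfl, h, rfl⟩

theorem wl_one (S : Set Γ) : wl S (1 : Γ) = 0 := by
  have := wl_le_of_word (S := S) ([] : List Γ) (by simp)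
  simpa using this

theorem wl_mul_le {S : Set Γ} (hS : IsGenSet S) (g h : Γ) : wl S (g * h) ≤ wl S g + wl S h := by
  obtain ⟨w, a1, a2, rfl⟩ := exists_min_word hS g
  obtain ⟨v, b1, b2, rfl⟩ := exists_min_word hS h
  rw [← a1, ← b1, ← List.prod_append, ← List.length_append]
  apply wl_le_of_word
  intro x hx
  rcases List.mem_append.1 hx with h | h
  · exact a2 x h
  · exact b2 x h

theorem wl_inv_le {S : Set Γ} (hS : IsGenSet S) (g : Γ) : wl S g⁻¹ ≤ wl S g := by
  obtain ⟨w, a1, a2, rfl⟩ := exists_min_word hS g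
  rw [← a1, List.prod_inv_reverse]
  refine (wl_le_of_word _ ?_).trans (by simp)
  intro x hx
  simp only [List.mem_reverse, List.mem_map] at hx
  obtain ⟨y, hy, rfl⟩ := hx
  exact hS.2.1 _ (a2 _ hy)

theorem wl_inv {S : Set Γ} (hS : IsGenSet S) (g : Γ) : wl S g⁻¹ = wl S g :=
  le_antisymm (wl_inv_le hS g) (by simpa using wl_inv_le hS g⁻¹)

theorem wl_le_one {S : Set Γ} {s : Γ} (hs : s ∈ S) : wl S s ≤ 1 := by
  simpa using wl_le_of_word [s] (by simpa using hs)

theorem finite_ball {S : Set Γ} (hS : IsGenSet S) (n : ℕ) : {g : Γ | wl S g ≤ n}.Finite := by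
  have hf : ∀ m : ℕ, {g : Γ | ∃ w : List Γ, w.length = m ∧ (∀ x ∈ w, x ∈ S) ∧ w.prod = g}.Finite := by
    intro m
    induction m with
    | zero =>
      refine (Set.finite_singleton (1 : Γ)).subset ?_
      rintro g ⟨w, h1, -, rfl⟩
      rw [List.length_eq_zero_iff] at h1
      simp [h1]
    | succ m ih =>
      refine ((hS.1.prod ih).image (fun p : Γ × Γ => p.1 * p.2)).subset ?_
      rintro g ⟨w, h1, h2, rfl⟩
      cases w with
      | nil => simp at h1
      | cons a v =>
        refine ⟨(a, v.prod), ⟨h2 a (by simp), v, by simpa using h1, fun x hx => h2 x (by simp [hx]), rfl⟩, by simp⟩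
  refine ((Set.finite_Iic n).biUnion (fun m _ => hf m)).subset ?_
  intro g hg
  simp only [Set.mem_iUnion]
  exact ⟨wl S g, hg, exists_min_word hS g⟩

theorem exists_start_seg {S : Set Γ} (hS : IsGenSet S) (g : Γ) (k : ℕ) (hk : k ≤ wl S g) :
    ∃ z : Γ, wl S z = k ∧ wl S (z⁻¹ * g) = wl S g - k := by
  obtain ⟨w, a1, a2, rfl⟩ := exists_min_word hS g
  have h1 : wl S (w.take k).prod ≤ k :=
    (wl_le_of_word _ fun x hx => a2 x (List.mem_of_mem_take hx)).trans (by simp)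
  have h2 : wl S (w.drop k).prod ≤ w.length - k :=
    (wl_le_of_word _ fun x hx => a2 x (List.mem_of_mem_drop hx)).trans (by simp)
  have h3 : w.prod = (w.take k).prod * (w.drop k).prod := by
    rw [← List.prod_append, List.take_append_drop]
  have h4 := wl_mul_le hS (w.take k).prod (w.drop k).prod
  rw [← h3] at h4
  refine ⟨(w.take k).prod, by omega, ?_⟩
  have h5 : (w.take k).prod⁻¹ * w.prod = (w.drop k).prod := by rw [h3]; group
  rw [h5]; omega

/-- Real-valued distance. -/
noncomputable def ds (S : Set Γ) (x y : Γ) : ℝ := (wl S (x⁻¹ * y) : ℝ)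

theorem ds_nonneg (S : Set Γ) (x y : Γ) : 0 ≤ ds S x y := Nat.cast_nonneg _
theorem ds_self (S : Set Γ) (x : Γ) : ds S x x = 0 := by simp [ds, wl_one]
theorem ds_comm {S : Set Γ} (hS : IsGenSet S) (x y : Γ) : ds S x y = ds S y x := by
  unfold ds; rw [← wl_inv hS]; simp
theorem ds_tri {S : Set Γ} (hS : IsGenSet S) (x y z : Γ) : ds S x z ≤ ds S x y + ds S y z := by
  unfold ds
  have := wl_mul_le hS (x⁻¹ * y) (y⁻¹ * z)
  rw [show x⁻¹ * y * (y⁻¹ * z) = x⁻¹ * z by group] at this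
  exact_mod_cast this
theorem ds_mul (S : Set Γ) (g x y : Γ) : ds S (g * x) (g * y) = ds S x y := by
  unfold ds; congr 2; group
theorem ds_one (S : Set Γ) (x : Γ) : ds S 1 x = wl S x := by simp [ds]
theorem ds_one' {S : Set Γ} (hS : IsGenSet S) (x : Γ) : ds S x 1 = wl S x := by
  rw [ds_comm hS, ds_one]

/-- Gromov product at the identity. -/
noncomputable def g1 (S : Set Γ) (x y : Γ) : ℝ := gp S 1 x y

theorem gp_eq (S : Set Γ) (z x y : Γ) : gp S z x y = (ds S x z + ds S y z - ds S x y) / 2 := rfl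

theorem g1_eq {S : Set Γ} (hS : IsGenSet S) (x y : Γ) :
    g1 S x y = ((wl S x : ℝ) + wl S y - ds S x y) / 2 := by
  rw [g1, gp_eq, ds_one' hS, ds_one' hS]

theorem g1_comm {S : Set Γ} (hS : IsGenSet S) (x y : Γ) : g1 S x y = g1 S y x := by
  rw [g1_eq hS, g1_eq hS, ds_comm hS]; ring
theorem g1_self {S : Set Γ} (hS : IsGenSet S) (x : Γ) : g1 S x x = wl S x := by
  rw [g1_eq hS, ds_self]; ring
theorem g1_nonneg {S : Set Γ} (hS : IsGenSet S) (x y : Γ) : 0 ≤ g1 S x y := by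
  have := ds_tri hS x 1 y
  rw [ds_one, ds_one' hS] at this
  rw [g1_eq hS]; linarith
theorem g1_le_left {S : Set Γ} (hS : IsGenSet S) (x y : Γ) : g1 S x y ≤ wl S x := by
  have := ds_tri hS 1 x y
  rw [ds_one, ds_one] at this
  rw [g1_eq hS]; linarith
theorem g1_le_right {S : Set Γ} (hS : IsGenSet S) (x y : Γ) : g1 S x y ≤ wl S y := by
  rw [g1_comm hS]; exact g1_le_left hS y x
theorem g1_lip {S : Set Γ} (hS : IsGenSet S) (x x' y : Γ) : g1 S x y ≤ g1 S x' y + ds S x x' := by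
  have h1 := ds_tri hS 1 x' x
  have h2 := ds_tri hS x' x y
  rw [ds_one, ds_one] at h1
  rw [g1_eq hS, g1_eq hS]
  rw [ds_comm hS x' x] at *
  linarith
theorem gp_trans (S : Set Γ) (z x y : Γ) : gp S z x y = g1 S (z⁻¹ * x) (z⁻¹ * y) := by
  rw [g1, gp_eq, gp_eq, ds_mul, ← ds_mul S z⁻¹ x z, ← ds_mul S z⁻¹ y z]; simp
/-- Translating both points changes the product by at most `|g|`. -/
theorem g1_mul {S : Set Γ} (hS : IsGenSet S) (g x y : Γ) : g1 S x y ≤ g1 S (g * x) (g * y) + wl S g := by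
  have h1 := ds_tri hS g⁻¹ 1 x
  have h2 := wl_mul_le hS g⁻¹ (g * x)
  have h3 := wl_mul_le hS g⁻¹ (g * y)
  rw [wl_inv hS, inv_mul_cancel_left] at h2 h3
  have h2' : (wl S x : ℝ) ≤ wl S g + wl S (g * x) := by exact_mod_cast h2
  have h3' : (wl S y : ℝ) ≤ wl S g + wl S (g * y) := by exact_mod_cast h3
  rw [g1_eq hS, g1_eq hS, ds_mul]; linarith
/-- `(g x | g) = |g| - (x | g⁻¹)`. -/
theorem g1_mul_left {S : Set Γ} (hS : IsGenSet S) (g x : Γ) :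
    g1 S (g * x) g = wl S g - g1 S x g⁻¹ := by
  rw [g1_eq hS, g1_eq hS, wl_inv hS]
  have h1 : ds S (g * x) g = wl S x := by
    have := ds_mul S g x 1
    rw [mul_one, ds_one' hS] at this; exact this
  have h2 : ds S x g⁻¹ = wl S (g * x) := by
    rw [← ds_mul S g, mul_inv_cancel, ds_one' hS]
  rw [h1, h2]; ring

theorem hyp {S : Set Γ} {δ : ℝ} (hδ : IsHyperbolic S δ) {x y : Γ} (z : Γ) {a : ℝ}
    (h1 : a ≤ g1 S x z) (h2 : a ≤ g1 S y z) : a - δ ≤ g1 S x y := by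
  have := hδ.2 x y z
  have h3 := le_min h1 h2
  unfold g1 at *
  linarith

theorem hyp' {S : Set Γ} {δ : ℝ} (hS : IsGenSet S) (hδ : IsHyperbolic S δ) {x y : Γ} (z : Γ) {a : ℝ}
    (h1 : a ≤ g1 S x z) (h2 : a ≤ g1 S z y) : a - δ ≤ g1 S x y :=
  hyp hδ z h1 (by rwa [g1_comm hS])

/-- If `(x|z)` is large and `(x|y)` is small then `(y|z)` is small. -/
theorem hyp_small {S : Set Γ} {δ : ℝ} (hδ : IsHyperbolic S δ) {x y : Γ} (z : Γ) {a : ℝ}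
    (h0 : g1 S x y ≤ a) (h1 : a + δ < g1 S x z) : g1 S y z ≤ a + δ := by
  by_contra h
  push Not at h
  have := hδ.2 x y z
  have h3 := lt_min h1 h
  unfold g1 at *
  linarith

theorem hypz {S : Set Γ} {δ : ℝ} (hδ : IsHyperbolic S δ) (o : Γ) {x y : Γ} (z : Γ) {a : ℝ}
    (h1 : a ≤ gp S o x z) (h2 : a ≤ gp S o y z) : a - δ ≤ gp S o x y := by
  rw [gp_trans] at *
  exact hyp hδ _ h1 h2



/-! ### Sequences converging to infinity -/

theorem pair_tendsto (f : ℕ × ℕ → ℝ) :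
    Tendsto f atTop atTop ↔ ∀ N : ℝ, ∃ n0 : ℕ, ∀ i ≥ n0, ∀ j ≥ n0, N ≤ f (i, j) := by
  rw [tendsto_atTop]
  refine forall_congr' fun N => ?_
  rw [eventually_atTop]
  constructor
  · rintro ⟨⟨a, b⟩, h⟩
    exact ⟨max a b, fun i hi j hj => h (i, j)
      ⟨(le_max_left _ _).trans hi, (le_max_right _ _).trans hj⟩⟩
  · rintro ⟨n0, h⟩
    exact ⟨(n0, n0), fun p hp => h p.1 hp.1 p.2 hp.2⟩

theorem convInf_iff {S : Set Γ} {u : ℕ → Γ} :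
    ConvInf S u ↔ ∀ N : ℝ, ∃ n0 : ℕ, ∀ i ≥ n0, ∀ j ≥ n0, N ≤ g1 S (u i) (u j) := pair_tendsto _

theorem equivSeq_iff {S : Set Γ} {u v : ℕ → Γ} :
    EquivSeq S u v ↔ ∀ N : ℝ, ∃ n0 : ℕ, ∀ i ≥ n0, ∀ j ≥ n0, N ≤ g1 S (u i) (v j) := pair_tendsto _

theorem EquivSeq.symm {S : Set Γ} (hS : IsGenSet S) {u v : ℕ → Γ} (h : EquivSeq S u v) :
    EquivSeq S v u := by
  rw [equivSeq_iff] at *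
  intro N
  obtain ⟨n0, h⟩ := h N
  exact ⟨n0, fun i hi j hj => by rw [g1_comm hS]; exact h j hj i hi⟩

theorem EquivSeq.trans {S : Set Γ} {δ : ℝ} (hS : IsGenSet S) (hδ : IsHyperbolic S δ)
    {u v w : ℕ → Γ} (h : EquivSeq S u v) (h' : EquivSeq S v w) : EquivSeq S u w := by
  rw [equivSeq_iff] at *
  intro N
  obtain ⟨n0, h⟩ := h (N + δ)
  obtain ⟨n1, h'⟩ := h' (N + δ)
  refine ⟨max n0 n1, fun i hi j hj => ?_⟩
  have := hyp' hS hδ (v (max n0 n1)) (h i ((le_max_left _ _).trans hi) _ (le_max_left _ _))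
    (h' _ (le_max_right _ _) j ((le_max_right _ _).trans hj))
  linarith

theorem ConvInf.of_equiv {S : Set Γ} {δ : ℝ} (hS : IsGenSet S) (hδ : IsHyperbolic S δ)
    {u v : ℕ → Γ} (h : EquivSeq S u v) : ConvInf S u :=
  EquivSeq.trans hS hδ h (h.symm hS)

theorem EquivSeq.mul {S : Set Γ} (hS : IsGenSet S) {u v : ℕ → Γ} (h : EquivSeq S u v) (g : Γ) :
    EquivSeq S (fun n => g * u n) (fun n => g * v n) := by
  rw [equivSeq_iff] at *
  intro N
  obtain ⟨n0, h⟩ := h (N + wl S g)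
  refine ⟨n0, fun i hi j hj => ?_⟩
  have := g1_mul hS g (u i) (v j)
  have := h i hi j hj
  linarith

theorem ConvInf.mul {S : Set Γ} (hS : IsGenSet S) {u : ℕ → Γ} (h : ConvInf S u) (g : Γ) :
    ConvInf S (fun n => g * u n) := EquivSeq.mul hS h g

theorem EquivSeq.sub {S : Set Γ} {u v : ℕ → Γ} (h : EquivSeq S u v) {φ ψ : ℕ → ℕ}
    (hφ : StrictMono φ) (hψ : StrictMono ψ) : EquivSeq S (u ∘ φ) (v ∘ ψ) := by
  rw [equivSeq_iff] at *
  intro N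
  obtain ⟨n0, h⟩ := h N
  exact ⟨n0, fun i hi j hj => h _ (hi.trans (hφ.id_le i)) _ (hj.trans (hψ.id_le j))⟩

theorem ConvInf.len {S : Set Γ} (hS : IsGenSet S) {u : ℕ → Γ} (h : ConvInf S u) (N : ℝ) :
    ∃ n0 : ℕ, ∀ i ≥ n0, N ≤ wl S (u i) := by
  obtain ⟨n0, h⟩ := convInf_iff.1 h N
  exact ⟨n0, fun i hi => by rw [← g1_self hS]; exact h i hi i hi⟩

/-- Sequential compactness of `Γ ∪ ∂Γ`. -/
theorem exists_convInf_subseq {S : Set Γ} (hS : IsGenSet S) (u : ℕ → Γ)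
    (hu : ∀ n, n ≤ wl S (u n)) : ∃ φ : ℕ → ℕ, StrictMono φ ∧ ConvInf S (u ∘ φ) := by
  have hp : ∀ k n : ℕ, ∃ z : Γ, wl S z ≤ k ∧
      (k ≤ wl S (u n) → wl S z = k ∧ wl S (z⁻¹ * u n) = wl S (u n) - k) := by
    intro k n
    by_cases h : k ≤ wl S (u n)
    · obtain ⟨z, h1, h2⟩ := exists_start_seg hS (u n) k h
      exact ⟨z, h1.le, fun _ => ⟨h1, h2⟩⟩
    · exact ⟨1, by simp [wl_one], fun h' => absurd h' h⟩
  choose π hπ1 hπ2 using hp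
  have hg : ∀ k, ∃ g : Γ, ∀ᶠ n in (hyperfilter ℕ : Filter ℕ), π k n = g := by
    intro k
    have := (Ultrafilter.eventually_exists_mem_iff (f := hyperfilter ℕ) (finite_ball hS k)
      (P := fun g n => π k n = g)).1 (Eventually.of_forall fun n => ⟨π k n, hπ1 k n, rfl⟩)
    obtain ⟨g, -, h⟩ := this
    exact ⟨g, h⟩
  choose g hg using hg
  have hle : (hyperfilter ℕ : Filter ℕ) ≤ atTop := by
    rw [← Nat.cofinite_eq_atTop]; exact hyperfilter_le_cofinite
  have hev : ∀ k, ∃ᶠ n in atTop, ∀ j ≤ k, j ≤ wl S (u n) ∧ π j n = g j := by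
    intro k
    have h1 : ∀ᶠ n in (hyperfilter ℕ : Filter ℕ), ∀ j ∈ Finset.range (k+1), j ≤ wl S (u n) ∧ π j n = g j := by
      rw [eventually_all_finset]
      intro j _
      have : ∀ᶠ n : ℕ in (hyperfilter ℕ : Filter ℕ), j ≤ n := hle (eventually_ge_atTop j)
      filter_upwards [this, hg j] with n h1 h2
      exact ⟨h1.trans (hu n), h2⟩
    refine Frequently.filter_mono ?_ hle
    refine (Eventually.frequently h1).mono fun n h j hj => h j (by simpa using Nat.lt_succ_of_le hj)
  obtain ⟨φ, hφ, h⟩ := extraction_forall_of_frequently hev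
  refine ⟨φ, hφ, convInf_iff.2 fun N => ?_⟩
  obtain ⟨m, hm⟩ := exists_nat_ge N
  refine ⟨m, fun i hi j hj => hm.trans ?_⟩
  obtain ⟨a1, a2⟩ := h i m hi
  obtain ⟨b1, b2⟩ := h j m hj
  obtain ⟨-, c1⟩ := hπ2 m (φ i) a1
  obtain ⟨-, c2⟩ := hπ2 m (φ j) b1
  rw [a2] at c1
  rw [b2] at c2
  have := ds_tri hS (u (φ i)) (g m) (u (φ j))
  rw [ds_comm hS (u (φ i)) (g m)] at this
  unfold ds at this
  rw [c1, c2] at this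
  push_cast [a1, b1] at this
  rw [g1_eq hS]
  simp only [Function.comp]
  unfold ds
  linarith

/-! ### Hyperbolic elements -/

theorem hypElem {S : Set Γ} {δ : ℝ} (hS : IsGenSet S) (hδ : IsHyperbolic S δ) {q : Γ} {C : ℝ}
    (hC : g1 S q q⁻¹ ≤ C) (hq : 2 * C + 2 * δ + 1 ≤ wl S q) :
    (∀ n : ℕ, g1 S (q ^ (n+1)) q⁻¹ ≤ C + δ) ∧
    (∀ n : ℕ, wl S q - C - δ ≤ g1 S (q ^ (n+1)) q) ∧ ConvInf S (fun n => q ^ n) ∧ ¬ IsOfFinOrder q := by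
  have h0 := hδ.1
  have hC0 : 0 ≤ C := (g1_nonneg hS _ _).trans hC
  have key : ∀ n : ℕ, g1 S (q ^ (n+1)) q⁻¹ ≤ C + δ := by
    intro n
    induction n with
    | zero => simpa using hC.trans (by linarith)
    | succ n ih =>
      have e := g1_mul_left hS q (q ^ (n+1))
      rw [← pow_succ'] at e
      have := hyp_small hδ (x := q) (y := q⁻¹) (q ^ (n+1+1)) hC (by rw [g1_comm hS]; linarith)
      rwa [g1_comm hS]
  have key2 : ∀ n : ℕ, wl S q - C - δ ≤ g1 S (q ^ (n+1)) q := by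
    intro n
    cases n with
    | zero => rw [zero_add, pow_one, g1_self hS]; linarith
    | succ n =>
      have e := g1_mul_left hS q (q ^ (n+1))
      rw [← pow_succ'] at e
      have := key n
      linarith
  have step : ∀ n : ℕ, (wl S (q ^ n) : ℝ) + 1 ≤ wl S (q ^ (n+1)) := by
    intro n
    cases n with
    | zero => simp only [pow_zero, wl_one, zero_add, pow_one]; push_cast; linarith
    | succ n =>
      have e := key n
      rw [g1_eq hS, wl_inv hS, ds_comm hS] at e
      unfold ds at e
      rw [inv_inv, ← pow_succ'] at e
      linarith
  have step2 : ∀ m n : ℕ, (wl S (q ^ m) : ℝ) + n ≤ wl S (q ^ (m+n)) := by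
    intro m n
    induction n with
    | zero => simp
    | succ n ih =>
      have := step (m+n)
      rw [← add_assoc]; push_cast; linarith
  have len : ∀ n : ℕ, (n : ℝ) ≤ wl S (q ^ n) := by
    intro n
    have := step2 0 n
    simpa [wl_one] using this
  have pw : ∀ m n : ℕ, (m : ℝ) ≤ g1 S (q ^ m) (q ^ (m + n)) := by
    intro m n
    rw [g1_eq hS]
    unfold ds
    rw [pow_add, inv_mul_cancel_left, ← pow_add]
    have h1 := step2 n m
    rw [add_comm n m] at h1
    have := len m
    linarith
  refine ⟨key, key2, convInf_iff.2 fun N => ?_, ?_⟩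
  · obtain ⟨k, hk⟩ := exists_nat_ge N
    refine ⟨k, fun i hi j hj => hk.trans ?_⟩
    rcases le_total i j with h | h
    · obtain ⟨c, rfl⟩ := Nat.exists_eq_add_of_le h
      exact (Nat.cast_le.2 hi).trans (pw i c)
    · obtain ⟨c, rfl⟩ := Nat.exists_eq_add_of_le h
      rw [g1_comm hS]
      exact (Nat.cast_le.2 hj).trans (pw j c)
  · intro hfin
    rw [isOfFinOrder_iff_pow_eq_one] at hfin
    obtain ⟨n, hn, h⟩ := hfin
    have := len n
    rw [h, wl_one] at this
    have : n ≤ 0 := by exact_mod_cast this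
    omega

/-! ### No global fixed point at infinity -/

theorem no_fixed {S : Set Γ} {δ : ℝ} (hS : IsGenSet S) (hδ : IsHyperbolic S δ)
    (hne : Nonelementary Γ) (u : ℕ → Γ) (hu : ConvInf S u)
    (hfix : ∀ s : Γ, EquivSeq S (fun n => s * u n) u) : False := by
  have h0 := hδ.1
  have hy : ∀ k : ℕ, ∃ y : Γ, wl S y = k ∧ ∃ n0 : ℕ, ∀ n ≥ n0, (k : ℝ) - δ ≤ g1 S y (u n) := by
    intro k
    obtain ⟨n0, hn0⟩ := convInf_iff.1 hu k
    have h1 := hn0 n0 le_rfl n0 le_rfl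
    rw [g1_self hS] at h1
    have h1 : k ≤ wl S (u n0) := by exact_mod_cast h1
    obtain ⟨y, hy1, hy2⟩ := exists_start_seg hS (u n0) k h1
    refine ⟨y, hy1, n0, fun n hn => hyp' hS hδ (u n0) ?_ (hn0 n0 le_rfl n hn)⟩
    rw [g1_eq hS]; unfold ds; rw [hy2, hy1]; push_cast [h1]; linarith
  choose y hy1 hy2 using hy
  have hyy : ∀ a b : ℕ, ds S (y a) (y b) ≤ |(a : ℝ) - b| + 4 * δ := by
    intro a b
    obtain ⟨n0, h1⟩ := hy2 a
    obtain ⟨n1, h2⟩ := hy2 b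
    have e1 := h1 (max n0 n1) (le_max_left _ _)
    have e2 := h2 (max n0 n1) (le_max_right _ _)
    have e3 := hyp hδ (a := min (a:ℝ) b - δ) (u (max n0 n1)) ((sub_le_sub_right (min_le_left _ _) _).trans e1)
      ((sub_le_sub_right (min_le_right _ _) _).trans e2)
    rw [g1_eq hS, hy1, hy1] at e3
    have : (a:ℝ) + b - 2 * min (a:ℝ) b = |(a:ℝ) - b| := by
      rcases le_total (a:ℝ) b with h | h
      · rw [min_eq_left h, abs_of_nonpos (by linarith)]; ring
      · rw [min_eq_right h, abs_of_nonneg (by linarith)]; ring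
    linarith
  have hyl : ∀ a b : ℕ, |(a : ℝ) - b| ≤ ds S (y a) (y b) := by
    intro a b
    have e1 := ds_tri hS 1 (y a) (y b)
    have e2 := ds_tri hS 1 (y b) (y a)
    rw [ds_comm hS (y b) (y a)] at e2
    simp only [ds_one, hy1] at e1 e2
    rw [abs_le]; constructor <;> linarith
  -- shift estimates
  have shift : ∀ (g : Γ) (k : ℕ), (wl S g : ℝ) + δ ≤ k →
      ds S (g * y k) (y (wl S (g * y k))) ≤ 8 * δ ∧
      ∃ n0 : ℕ, ∀ n ≥ n0, |(wl S (g * y k) : ℝ) - k - (wl S (g * u n) - wl S (u n))| ≤ 2 * δ := by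
    intro g k hk
    have main : ∃ n0 : ℕ, ∀ n ≥ n0,
        |(wl S (g * y k) : ℝ) - k - (wl S (g * u n) - wl S (u n))| ≤ 2 * δ ∧
        (wl S (g * y k) : ℝ) - 2 * δ ≤ g1 S (g * y k) (g * u n) := by
      obtain ⟨n0, hn0⟩ := hy2 k
      refine ⟨n0, fun n hn => ?_⟩
      have e1 := hn0 n hn
      have e2 := ds_tri hS g⁻¹ (y k) (u n)
      have e3 := hyp' hS hδ (a := g1 S g⁻¹ (u n)) (x := g⁻¹) (y := y k) (u n) le_rfl (by
        have := g1_le_left hS g⁻¹ (u n)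
        rw [wl_inv hS] at this
        rw [g1_comm hS (u n) (y k)]; linarith)
      have e4 : ds S g⁻¹ (y k) = wl S (g * y k) := by unfold ds; rw [inv_inv]
      have e5 : ds S g⁻¹ (u n) = wl S (g * u n) := by unfold ds; rw [inv_inv]
      rw [g1_eq hS, hy1] at e1
      rw [g1_eq hS, g1_eq hS, e4, e5, hy1] at e3
      rw [e4, e5] at e2
      refine ⟨by rw [abs_le]; constructor <;> linarith, ?_⟩
      rw [g1_eq hS, ds_mul]; linarith
    obtain ⟨n0, hn0⟩ := main
    refine ⟨?_, n0, fun n hn => (hn0 n hn).1⟩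
    set j := wl S (g * y k) with hj
    obtain ⟨n1, hn1⟩ := hy2 j
    obtain ⟨n2, hn2⟩ := equivSeq_iff.1 (hfix g) j
    set n := max n0 (max n1 n2)
    have a1 := (hn0 n (le_max_left _ _)).2
    have a2 := hn1 n ((le_max_left _ _).trans (le_max_right _ _))
    have a3 := hn2 n ((le_max_right _ _).trans (le_max_right _ _)) n
      ((le_max_right _ _).trans (le_max_right _ _))
    have b1 := hyp' hS hδ (a := (j:ℝ) - 2 * δ) (x := g * y k) (y := u n) (g * u n) a1 (by linarith)
    have b2 := hyp hδ (a := (j:ℝ) - 3 * δ) (x := g * y k) (y := y j) (u n) (by linarith) (by linarith)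
    rw [g1_eq hS, hy1, ← hj] at b2
    linarith
  -- the translation relation
  let T : Γ → ℤ → ℝ → Prop := fun g i D =>
    ∃ k0 : ℕ, ∀ k ≥ k0, ds S (g * y k) (y ((k : ℤ) + i).toNat) ≤ D
  have Tex : ∀ g, ∃ i, T g i (16 * δ) := by
    intro g
    obtain ⟨k0, hk0⟩ := exists_nat_ge ((wl S g : ℝ) + δ)
    refine ⟨(wl S (g * y k0) : ℤ) - k0, k0, fun k hk => ?_⟩
    obtain ⟨-, n0, hn0⟩ := shift g k0 hk0
    obtain ⟨a, n1, hn1⟩ := shift g k (hk0.trans (Nat.cast_le.2 hk))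
    have b1 := hn0 (max n0 n1) (le_max_left _ _)
    have b2 := hn1 (max n0 n1) (le_max_right _ _)
    set m := ((k : ℤ) + ((wl S (g * y k0) : ℤ) - k0)).toNat with hm
    have hm' : (m : ℤ) = (k : ℤ) + ((wl S (g * y k0) : ℤ) - k0) := by omega
    have hm'' : (m : ℝ) = (k : ℝ) + ((wl S (g * y k0) : ℝ) - k0) := by exact_mod_cast hm'
    have c := hyy (wl S (g * y k)) m
    have d1 := ds_tri hS (g * y k) (y (wl S (g * y k))) (y m)
    have : |(wl S (g * y k) : ℝ) - m| ≤ 4 * δ := by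
      rw [hm'', abs_le]; rw [abs_le] at b1 b2; constructor <;> linarith [b1.1, b1.2, b2.1, b2.2]
    linarith
  have Tmul : ∀ g h i j D D', T g i D → T h j D' → T (g * h) (i + j) (D + D') := by
    rintro g h i j D D' ⟨k0, h1⟩ ⟨k1, h2⟩
    refine ⟨k0 + k1 + j.natAbs, fun k hk => ?_⟩
    have a1 := h2 k (by omega)
    have a2 := h1 ((k : ℤ) + j).toNat (by omega)
    have a3 : (((((k : ℤ) + j).toNat : ℕ) : ℤ) + i).toNat = ((k : ℤ) + (i + j)).toNat := by omega
    rw [a3] at a2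
    have := ds_tri hS (g * h * y k) (g * y ((k : ℤ) + j).toNat) (y ((k : ℤ) + (i + j)).toNat)
    rw [mul_assoc, ds_mul] at this
    rw [mul_assoc]
    linarith
  have Tinv : ∀ g i D, T g i D → T g⁻¹ (-i) D := by
    rintro g i D ⟨k0, h1⟩
    refine ⟨k0 + i.natAbs, fun k hk => ?_⟩
    have a1 := h1 ((k : ℤ) + -i).toNat (by omega)
    have a3 : (((((k : ℤ) + -i).toNat : ℕ) : ℤ) + i).toNat = k := by omega
    rw [a3] at a1
    rw [← ds_mul S g, mul_inv_cancel_left, ds_comm hS]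
    exact a1
  have Tuniq : ∀ g i j D D', T g i D → T g j D' → |(i : ℝ) - j| ≤ D + D' := by
    rintro g i j D D' ⟨k0, h1⟩ ⟨k1, h2⟩
    set k := k0 + k1 + i.natAbs + j.natAbs with hk
    have a1 := h1 k (by omega)
    have a2 := h2 k (by omega)
    have a3 := hyl ((k : ℤ) + i).toNat ((k : ℤ) + j).toNat
    have e1 : ((((k : ℤ) + i).toNat : ℕ) : ℝ) = k + i := by
      have : ((((k : ℤ) + i).toNat : ℕ) : ℤ) = k + i := by omega
      exact_mod_cast this
    have e2 : ((((k : ℤ) + j).toNat : ℕ) : ℝ) = k + j := by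
      have : ((((k : ℤ) + j).toNat : ℕ) : ℤ) = k + j := by omega
      exact_mod_cast this
    rw [e1, e2] at a3
    have := ds_tri hS (y ((k : ℤ) + i).toNat) (g * y k) (y ((k : ℤ) + j).toNat)
    rw [ds_comm hS (y ((k : ℤ) + i).toNat) (g * y k)] at this
    rw [show (k:ℝ) + i - (k + j) = i - j by ring] at a3
    linarith
  have Tfin : ∀ (c : ℕ) (D : ℝ), {g : Γ | ∃ i : ℤ, i.natAbs ≤ c ∧ T g i D}.Finite := by
    intro c D
    by_contra hinf
    obtain ⟨N, hN⟩ := exists_nat_ge (D + c + 4 * δ)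
    obtain ⟨F, hF, hcard⟩ := Set.Infinite.exists_subset_card_eq hinf ((finite_ball hS N).toFinset.card + 1)
    have : ∀ g ∈ F, ∃ k0 : ℕ, ∀ k ≥ k0, wl S ((y k)⁻¹ * (g * y k)) ≤ N := by
      intro g hg
      obtain ⟨i, hi, k0, h1⟩ := hF hg
      refine ⟨k0 + c, fun k hk => ?_⟩
      have a1 := h1 k (by omega)
      have a2 := hyy ((k : ℤ) + i).toNat k
      have e1 : ((((k : ℤ) + i).toNat : ℕ) : ℝ) = k + i := by
        have : ((((k : ℤ) + i).toNat : ℕ) : ℤ) = k + i := by omega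
        exact_mod_cast this
      rw [e1, add_sub_cancel_left] at a2
      have a3 : |(i : ℝ)| ≤ c := by
        have : |i| ≤ c := by rw [Int.abs_eq_natAbs]; exact_mod_cast hi
        exact_mod_cast this
      have a4 := ds_tri hS (g * y k) (y ((k : ℤ) + i).toNat) (y k)
      rw [ds_comm hS (g * y k) (y k)] at a4
      have a5 : ds S (y k) (g * y k) ≤ N := by linarith
      unfold ds at a5
      exact_mod_cast a5
    choose! k0 hk0 using this
    set K := F.sup k0
    have hle : F.card ≤ (finite_ball hS N).toFinset.card := by
      refine Finset.card_le_card_of_injOn (fun g => (y K)⁻¹ * (g * y K)) ?_ ?_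
      · intro g hg
        simpa using hk0 g hg K (Finset.le_sup hg)
      · intro a _ b _ hab
        simpa using hab
    omega
  -- a loxodromic element
  obtain ⟨l, hl⟩ := exists_nat_ge (4 * δ + 64 * δ + 2)
  set t := (y l)⁻¹ with ht
  obtain ⟨it, hit⟩ := Tex t
  have hit2 : 48 * δ < |(it : ℝ)| := by
    obtain ⟨k0, h1⟩ := hit
    set k := k0 + l + it.natAbs with hk
    have a1 := h1 k (by omega)
    have a2 := hyy l k
    have a3 := ds_tri hS 1 (t * y k) (y ((k : ℤ) + it).toNat)
    rw [ds_one, hy1, ds_one] at a3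
    have a3 := ds_tri hS 1 (t * y k) (y ((k : ℤ) + it).toNat)
    rw [ds_one, hy1, ds_one] at a3
    have a4 : (wl S (t * y k) : ℝ) = ds S (y l) (y k) := rfl
    have e1 : ((((k : ℤ) + it).toNat : ℕ) : ℝ) = k + it := by
      have : ((((k : ℤ) + it).toNat : ℕ) : ℤ) = k + it := by omega
      exact_mod_cast this
    rw [e1, a4] at a3
    have a5 : |(l : ℝ) - k| = k - l := by
      have : l ≤ k := by omega
      have : (l : ℝ) ≤ k := by exact_mod_cast this
      rw [abs_of_nonpos (by linarith)]; ring
    have := neg_abs_le (it : ℝ)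
    linarith
  have red : ∀ b : ℕ, ∀ g i, i.natAbs ≤ b → T g i (16 * δ) →
      ∃ n : ℤ, ∃ i' : ℤ, i'.natAbs ≤ it.natAbs ∧ T (t ^ n * g) i' (16 * δ) := by
    intro b
    induction b with
    | zero => exact fun g i hi hT => ⟨0, i, by omega, by simpa using hT⟩
    | succ b ih =>
      intro g i hi hT
      by_cases hc : i.natAbs ≤ it.natAbs
      · exact ⟨0, i, hc, by simpa using hT⟩
      have hex : ∃ e : ℤ, ∃ ie : ℤ, T (t ^ e) ie (16 * δ) ∧ (i + ie).natAbs = i.natAbs - it.natAbs := by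
        rcases le_total 0 (i * it) with h | h
        · refine ⟨-1, -it, by simpa using Tinv _ _ _ hit, ?_⟩
          rcases mul_nonneg_iff.1 h with h | h <;> omega
        · refine ⟨1, it, by simpa using hit, ?_⟩
          rcases mul_nonpos_iff.1 h with h | h <;> omega
      obtain ⟨e, ie, he, hie⟩ := hex
      obtain ⟨i', hi'⟩ := Tex (t ^ e * g)
      have a1 := Tuniq _ _ _ _ _ hi' (Tmul _ _ _ _ _ _ he hT)
      have a2 : ((ie + i).natAbs : ℝ) = i.natAbs - it.natAbs := by
        rw [add_comm, hie]; push_cast [(not_le.1 hc).le]; ring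
      have a3 : ((i'.natAbs : ℕ) : ℝ) ≤ b := by
        have h1 : ((i'.natAbs : ℕ) : ℝ) = |(i' : ℝ)| := by rw [Nat.cast_natAbs]; push_cast; rfl
        have h2 : (((ie + i).natAbs : ℕ) : ℝ) = |((ie + i : ℤ) : ℝ)| := by rw [Nat.cast_natAbs]; push_cast; rfl
        have h3 : ((it.natAbs : ℕ) : ℝ) = |(it : ℝ)| := by rw [Nat.cast_natAbs]; push_cast; rfl
        have h4 := abs_sub_abs_le_abs_sub (i' : ℝ) ((ie + i : ℤ) : ℝ)
        have h5 : ((i.natAbs : ℕ) : ℝ) ≤ b + 1 := by exact_mod_cast hi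
        have h6 : ((i'.natAbs : ℕ) : ℝ) < b + 1 := by linarith
        have : i'.natAbs < b + 1 := by exact_mod_cast h6
        exact_mod_cast Nat.lt_succ_iff.1 this
      obtain ⟨n, j, hj, hT'⟩ := ih _ i' (by exact_mod_cast a3) hi'
      refine ⟨n + e, j, hj, ?_⟩
      rw [zpow_add, mul_assoc]; exact hT'
  have hfin := Tfin it.natAbs (16 * δ)
  have hindex : (Subgroup.zpowers t).index ≠ 0 := by
    have hsurj : Function.Surjective (fun f : {g : Γ | ∃ i : ℤ, i.natAbs ≤ it.natAbs ∧ T g i (16 * δ)} =>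
        ((f.1⁻¹ : Γ) : Γ ⧸ Subgroup.zpowers t)) := by
      intro x
      obtain ⟨g, rfl⟩ := QuotientGroup.mk_surjective x
      obtain ⟨i, hi⟩ := Tex g⁻¹
      obtain ⟨n, i', h1, h2⟩ := red _ g⁻¹ i le_rfl hi
      refine ⟨⟨t ^ n * g⁻¹, i', h1, h2⟩, ?_⟩
      simp only
      rw [QuotientGroup.eq]
      exact ⟨n, by simp⟩
    have : Finite {g : Γ | ∃ i : ℤ, i.natAbs ≤ it.natAbs ∧ T g i (16 * δ)} := hfin
    have : Finite (Γ ⧸ Subgroup.zpowers t) := Finite.of_surjective _ hsurj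
    exact Subgroup.index_ne_zero_of_finite
  exact hindex (hne t)

/-- Uniform version of the absence of fixed points. -/
theorem exists_move {S : Set Γ} {δ : ℝ} (hS : IsGenSet S) (hδ : IsHyperbolic S δ)
    (hne : Nonelementary Γ) :
    ∃ C : ℝ, 0 ≤ C ∧ ∀ y z : Γ, ∃ s : Γ, (wl S s : ℝ) ≤ C ∧ g1 S (s * y) z ≤ C := by
  by_contra hcon
  push Not at hcon
  have := fun n : ℕ => hcon n (Nat.cast_nonneg n)
  choose y z h using this
  have hlen : ∀ n, n ≤ wl S (z n) := by
    intro n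
    have h1 := h n 1 (by simp [wl_one])
    have h2 := g1_le_right hS (1 * y n) (z n)
    have : (n : ℝ) < wl S (z n) := h1.trans_le h2
    exact_mod_cast this.le
  obtain ⟨φ, hφ, hc⟩ := exists_convInf_subseq hS z hlen
  have heq : ∀ s, EquivSeq S (fun n => s * y (φ n)) (z ∘ φ) := by
    intro s
    rw [equivSeq_iff]
    intro N
    obtain ⟨n0, hn0⟩ := convInf_iff.1 hc (N + δ)
    obtain ⟨n1, hn1⟩ := exists_nat_ge (N + δ)
    refine ⟨max n0 (max n1 (wl S s)), fun i hi j hj => ?_⟩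
    simp only [ge_iff_le, max_le_iff] at hi hj
    have a1 := h (φ i) s (by exact_mod_cast hi.2.2.trans (hφ.id_le i))
    have a2 : (n1 : ℝ) ≤ φ i := by exact_mod_cast hi.2.1.trans (hφ.id_le i)
    have := hyp' hS hδ (a := N + δ) (z (φ i)) (x := s * y (φ i)) (y := z (φ j)) (by linarith) (hn0 i hi.1 j hj.1)
    simp only [Function.comp]
    linarith
  have h1 := heq 1
  simp only [one_mul] at h1
  refine no_fixed hS hδ hne (fun n => y (φ n)) (ConvInf.of_equiv hS hδ h1) fun s => ?_
  exact (heq s).trans hS hδ (h1.symm hS)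



/-! ### The Green function as an extended nonnegative real -/

open Classical in
noncomputable def PE (m : Γ → ℝ≥0∞) : ℕ → Γ → Γ → ℝ≥0∞
  | 0 => fun x y => if x = y then 1 else 0
  | n + 1 => fun x y => ∑' z : Γ, PE m n x z * m (z⁻¹ * y)

noncomputable def GE (m : Γ → ℝ≥0∞) (x y : Γ) : ℝ≥0∞ := ∑' n : ℕ, PE m n x y

structure Walk (S : Set Γ) (m : Γ → ℝ≥0∞) : Prop where
  total : ∑' g, m g = 1
  supp : ∀ g, m g ≠ 0 → g ∈ S
  nondeg : ∀ g : Γ, ∃ l : List Γ, (∀ x ∈ l, m x ≠ 0) ∧ l.prod = g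

theorem PE_zero_self (m : Γ → ℝ≥0∞) (x : Γ) : PE m 0 x x = 1 := by simp [PE]

theorem PE_add (m : Γ → ℝ≥0∞) (a b : ℕ) (x y : Γ) :
    PE m (a + b) x y = ∑' z, PE m a x z * PE m b z y := by
  classical
  induction b generalizing y with
  | zero =>
    simp only [add_zero, PE]
    rw [tsum_eq_single y]
    · simp
    · intro b hb; simp [hb]
  | succ b ih =>
    rw [← add_assoc]
    simp only [PE]
    simp_rw [ih, ← ENNReal.tsum_mul_right, ← ENNReal.tsum_mul_left]
    rw [ENNReal.tsum_comm]
    simp_rw [mul_assoc]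

theorem PE_one (m : Γ → ℝ≥0∞) (x y : Γ) : PE m 1 x y = m (x⁻¹ * y) := by
  classical
  simp only [PE]
  rw [tsum_eq_single x]
  · simp
  · intro b hb; simp [Ne.symm hb]

theorem PE_succ' (m : Γ → ℝ≥0∞) (n : ℕ) (x y : Γ) :
    PE m (n + 1) x y = ∑' z, m (x⁻¹ * z) * PE m n z y := by
  rw [add_comm, PE_add]; simp_rw [PE_one]

theorem PE_mul (m : Γ → ℝ≥0∞) (n : ℕ) (g x y : Γ) : PE m n (g * x) (g * y) = PE m n x y := by
  induction n generalizing y with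
  | zero => by_cases h : x = y <;> simp [PE, h]
  | succ n ih =>
    simp only [PE]
    rw [← (Equiv.mulLeft g).tsum_eq]
    refine tsum_congr fun z => ?_
    simp only [Equiv.coe_mulLeft, ih]
    congr 2; group

theorem PE_rev (m : Γ → ℝ≥0∞) (n : ℕ) (x y : Γ) :
    PE (fun g => m g⁻¹) n y x = PE m n x y := by
  induction n generalizing y with
  | zero => by_cases h : x = y <;> simp [PE, h, Ne.symm]
  | succ n ih =>
    rw [PE_succ']
    simp only [PE]
    refine tsum_congr fun z => ?_
    rw [ih, mul_comm]
    congr 2; group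

theorem GE_rev (m : Γ → ℝ≥0∞) (x y : Γ) : GE (fun g => m g⁻¹) y x = GE m x y :=
  tsum_congr fun n => PE_rev m n x y

theorem GE_mul (m : Γ → ℝ≥0∞) (g x y : Γ) : GE m (g * x) (g * y) = GE m x y :=
  tsum_congr fun n => PE_mul m n g x y

theorem Walk.rev {S : Set Γ} {m : Γ → ℝ≥0∞} (hS : IsGenSet S) (h : Walk S m) :
    Walk S (fun g => m g⁻¹) := by
  refine ⟨?_, fun g hg => by simpa using hS.2.1 _ (h.supp _ hg), fun g => ?_⟩
  · rw [← h.total]; exact (Equiv.inv Γ).tsum_eq m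
  · obtain ⟨l, h1, h2⟩ := h.nondeg g⁻¹
    refine ⟨(l.map (·⁻¹)).reverse, ?_, ?_⟩
    · intro x hx
      simp only [List.mem_reverse, List.mem_map] at hx
      obtain ⟨a, ha, rfl⟩ := hx
      simpa using h1 a ha
    · rw [← List.prod_inv_reverse, h2, inv_inv]

theorem PE_sum {S : Set Γ} {m : Γ → ℝ≥0∞} (h : Walk S m) (n : ℕ) (x : Γ) :
    ∑' y, PE m n x y = 1 := by
  classical
  induction n with
  | zero => simp [PE]
  | succ n ih =>
    simp only [PE]
    rw [ENNReal.tsum_comm]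
    simp_rw [ENNReal.tsum_mul_left]
    have : ∀ z : Γ, ∑' y, m (z⁻¹ * y) = 1 := fun z => by
      rw [← h.total]; exact (Equiv.mulLeft z⁻¹).tsum_eq m
    simp_rw [this, mul_one, ih]

theorem PE_le_one {S : Set Γ} {m : Γ → ℝ≥0∞} (h : Walk S m) (n : ℕ) (x y : Γ) :
    PE m n x y ≤ 1 := (ENNReal.le_tsum y).trans (PE_sum h n x).le

theorem PE_ne_top {S : Set Γ} {m : Γ → ℝ≥0∞} (h : Walk S m) (n : ℕ) (x y : Γ) :
    PE m n x y ≠ ⊤ := ((PE_le_one h n x y).trans_lt ENNReal.one_lt_top).ne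

theorem PE_pos {S : Set Γ} {m : Γ → ℝ≥0∞} (h : Walk S m) (x y : Γ) :
    ∃ n, PE m n x y ≠ 0 := by
  obtain ⟨l, h1, h2⟩ := h.nondeg (x⁻¹ * y)
  refine ⟨l.length, ?_⟩
  have : ∀ l : List Γ, (∀ x ∈ l, m x ≠ 0) → ∀ x, PE m l.length x (x * l.prod) ≠ 0 := by
    intro l
    induction l with
    | nil => intro _ x; simp [PE]
    | cons a l ih =>
      intro hl x
      rw [List.length_cons, PE_succ']
      refine fun h0 => ?_
      have := (ENNReal.tsum_eq_zero.1 h0) (x * a)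
      rw [List.prod_cons, ← mul_assoc x] at this
      rcases mul_eq_zero.1 this with h | h
      · exact hl a (by simp) (by simpa using h)
      · exact ih (fun y hy => hl y (by simp [hy])) (x * a) h
  simpa [h2] using this l h1 x

theorem PE_GE_le (m : Γ → ℝ≥0∞) (n : ℕ) (x y : Γ) :
    ∑' z, PE m n x z * GE m z y ≤ GE m x y := by
  unfold GE
  simp_rw [← ENNReal.tsum_mul_left]
  rw [ENNReal.tsum_comm]
  simp_rw [← PE_add]
  exact ENNReal.tsum_comp_le_tsum_of_injective (add_right_injective n) (fun k => PE m k x y)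

theorem one_le_GE (m : Γ → ℝ≥0∞) (x : Γ) : 1 ≤ GE m x x := by
  rw [← PE_zero_self m x]; exact ENNReal.le_tsum 0

/-- Harnack inequality. -/
theorem harnack {S : Set Γ} {m : Γ → ℝ≥0∞} (hS : IsGenSet S) (h : Walk S m) :
    ∃ κ : ℝ≥0∞, κ ≠ 0 ∧ κ ≤ 1 ∧ (∀ x x' y, κ ^ wl S (x⁻¹ * x') * GE m x' y ≤ GE m x y) ∧
      ∀ x y, κ ^ wl S (x⁻¹ * y) ≤ GE m x y := by
  choose n hn using fun s => PE_pos h 1 s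
  obtain ⟨κ, hκ⟩ : ∃ κ : ℝ≥0∞, κ = ∏ s ∈ hS.1.toFinset, PE m (n s) 1 s := ⟨_, rfl⟩
  have hle : ∀ s ∈ S, κ ≤ PE m (n s) 1 s := by
    intro s hs
    rw [hκ]
    have := Finset.prod_le_prod_of_subset_of_le_one' (s := {s}) (t := hS.1.toFinset)
      (f := fun s => PE m (n s) 1 s) (by simpa using hs) (fun i _ _ => PE_le_one h _ _ _)
    simpa using this
  have step : ∀ x y : Γ, ∀ s ∈ S, κ * GE m (x * s) y ≤ GE m x y := by
    intro x y s hs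
    refine le_trans ?_ (PE_GE_le m (n s) x y)
    refine le_trans ?_ (ENNReal.le_tsum (x * s))
    gcongr
    have := PE_mul m (n s) x 1 s
    rw [mul_one] at this
    rw [this]
    exact hle s hs
  have main : ∀ x x' y, κ ^ wl S (x⁻¹ * x') * GE m x' y ≤ GE m x y := by
    intro x x' y
    obtain ⟨w, hw1, hw2, hw3⟩ := exists_min_word hS (x⁻¹ * x')
    have : ∀ w : List Γ, (∀ s ∈ w, s ∈ S) → ∀ x, κ ^ w.length * GE m (x * w.prod) y ≤ GE m x y := by
      intro w
      induction w with
      | nil => intro _ x; simp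
      | cons a w ih =>
        intro hw x
        rw [List.length_cons, List.prod_cons, pow_succ', mul_assoc, ← mul_assoc x]
        refine le_trans ?_ (step x y a (hw a (by simp)))
        gcongr
        exact ih (fun s hs => hw s (by simp [hs])) _
    have := this w hw2 x
    rwa [hw1, hw3, mul_inv_cancel_left] at this
  refine ⟨κ, ?_, ?_, main, fun x y => ?_⟩
  · rw [hκ, Finset.prod_ne_zero_iff]; exact fun s _ => hn s
  · rw [hκ]; exact Finset.prod_le_one' fun s _ => PE_le_one h _ _ _
  · refine le_trans ?_ (main x y y)
    exact le_mul_of_one_le_right' (one_le_GE m y)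

theorem GE_pos {S : Set Γ} {m : Γ → ℝ≥0∞} (h : Walk S m) (x y : Γ) : GE m x y ≠ 0 := by
  obtain ⟨n, hn⟩ := PE_pos h x y
  exact fun h0 => hn (ENNReal.tsum_eq_zero.1 h0 n)

theorem GE_fin {S : Set Γ} {m : Γ → ℝ≥0∞} (hS : IsGenSet S) (h : Walk S m) {y0 : Γ}
    (h0 : GE m 1 y0 ≠ ⊤) (x y : Γ) : GE m x y ≠ ⊤ := by
  obtain ⟨κ, k0, k1, k2, -⟩ := harnack hS h
  intro ht
  have := k2 1 (y0 * y⁻¹ * x) y0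
  rw [show GE m (y0 * y⁻¹ * x) y0 = GE m x y by
    rw [← GE_mul m (y0 * y⁻¹) x y]; congr 1; group] at this
  rw [ht, ENNReal.mul_top (pow_ne_zero _ k0)] at this
  exact h0 (top_le_iff.1 this)

/-! ### Link with the real-valued definitions -/

noncomputable def mE (μ : Γ → ℝ) (g : Γ) : ℝ≥0∞ := ENNReal.ofReal (μ g)

theorem walk_mE {S : Set Γ} {μ : Γ → ℝ} (hμ : IsRWMeasure S μ) : Walk S (mE μ) := by
  have hs : Summable μ := by
    by_contra h
    have := hμ.total
    rw [tsum_eq_zero_of_not_summable h] at this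
    exact zero_ne_one this
  refine ⟨?_, fun g hg => hμ.support_subset g fun h => hg (by simp [mE, h]), fun g => ?_⟩
  · unfold mE
    rw [← ENNReal.ofReal_tsum_of_nonneg hμ.nonneg hs, hμ.total, ENNReal.ofReal_one]
  · obtain ⟨l, -, h1, h2⟩ := hμ.nondeg g
    exact ⟨l, fun x hx => by simpa [mE] using h1 x hx, h2⟩

theorem ptrans_eq {S : Set Γ} {μ : Γ → ℝ} (hμ : IsRWMeasure S μ) (n : ℕ) (x y : Γ) :
    ptrans μ n x y = (PE (mE μ) n x y).toReal := by
  induction n generalizing y with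
  | zero => simp only [ptrans, PE]; split_ifs <;> simp
  | succ n ih =>
    simp only [ptrans, PE]
    rw [ENNReal.tsum_toReal_eq]
    · refine tsum_congr fun z => ?_
      rw [ih, ENNReal.toReal_mul, mE, ENNReal.toReal_ofReal (hμ.nonneg _)]
    · exact fun z => ENNReal.mul_ne_top (PE_ne_top (walk_mE hμ) _ _ _) ENNReal.ofReal_ne_top

theorem green_eq {S : Set Γ} {μ : Γ → ℝ} (hμ : IsRWMeasure S μ) (x y : Γ) :
    green μ x y = (GE (mE μ) x y).toReal := by
  unfold green GE
  rw [ENNReal.tsum_toReal_eq fun n => PE_ne_top (walk_mE hμ) _ _ _]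
  exact tsum_congr fun n => ptrans_eq hμ n x y

theorem martinK_eq {S : Set Γ} {μ : Γ → ℝ} (hμ : IsRWMeasure S μ) (x y : Γ) :
    martinK μ x y = (GE (mE μ) x y / GE (mE μ) 1 y).toReal := by
  rw [martinK, green_eq hμ, green_eq hμ, ENNReal.toReal_div]



/-! ### Stopping the walk at a barrier -/

open Classical in
noncomputable def AV (m : Γ → ℝ≥0∞) (W : Set Γ) : ℕ → Γ → Γ → ℝ≥0∞
  | 0 => fun x y => if x ∉ W ∧ x = y then 1 else 0
  | n + 1 => fun x y => if x ∈ W then 0 else ∑' z, m (x⁻¹ * z) * AV m W n z y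

open Classical in
noncomputable def HT (m : Γ → ℝ≥0∞) (W : Set Γ) : ℕ → Γ → Γ → ℝ≥0∞
  | 0 => fun x v => if x ∈ W ∧ x = v then 1 else 0
  | n + 1 => fun x v => if x ∈ W then 0 else ∑' z, m (x⁻¹ * z) * HT m W n z v

noncomputable def HH (m : Γ → ℝ≥0∞) (W : Set Γ) (x v : Γ) : ℝ≥0∞ := ∑' k, HT m W k x v

def Ch (S W : Set Γ) : ℕ → Γ → Γ → Prop
  | 0 => fun x y => x ∉ W ∧ x = y
  | n + 1 => fun x y => x ∉ W ∧ ∃ z, x⁻¹ * z ∈ S ∧ Ch S W n z y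

theorem AV_le (m : Γ → ℝ≥0∞) (W : Set Γ) (n : ℕ) (x y : Γ) : AV m W n x y ≤ PE m n x y := by
  induction n generalizing x with
  | zero => simp only [AV, PE]; split_ifs <;> simp_all
  | succ n ih =>
    rw [PE_succ']
    simp only [AV]
    split_ifs
    · simp
    · exact ENNReal.tsum_le_tsum fun z => by gcongr; exact ih z

theorem AV_chain {S : Set Γ} {m : Γ → ℝ≥0∞} (h : Walk S m) (W : Set Γ) (n : ℕ) (x y : Γ)
    (h0 : AV m W n x y ≠ 0) : Ch S W n x y := by
  induction n generalizing x with
  | zero => simpa [AV, Ch] using h0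
  | succ n ih =>
    simp only [AV] at h0
    split_ifs at h0 with hx
    · exact absurd rfl h0
    · rw [Ne, ENNReal.tsum_eq_zero, not_forall] at h0
      obtain ⟨z, hz⟩ := h0
      obtain ⟨h1, h2⟩ := mul_ne_zero_iff.1 hz
      exact ⟨hx, z, h.supp _ h1, ih z h2⟩

theorem HT_supp (m : Γ → ℝ≥0∞) (W : Set Γ) (n : ℕ) (x v : Γ) (h0 : HT m W n x v ≠ 0) : v ∈ W := by
  induction n generalizing x with
  | zero =>
    have : x ∈ W ∧ x = v := by simpa [HT] using h0
    exact this.2 ▸ this.1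
  | succ n ih =>
    simp only [HT] at h0
    split_ifs at h0 with hx
    · exact absurd rfl h0
    · rw [Ne, ENNReal.tsum_eq_zero, not_forall] at h0
      obtain ⟨z, hz⟩ := h0
      exact ih z (mul_ne_zero_iff.1 hz).2

theorem HH_supp (m : Γ → ℝ≥0∞) (W : Set Γ) (x v : Γ) (h0 : HH m W x v ≠ 0) : v ∈ W := by
  rw [HH, Ne, ENNReal.tsum_eq_zero, not_forall] at h0
  obtain ⟨n, hn⟩ := h0
  exact HT_supp m W n x v hn

theorem GE_step (m : Γ → ℝ≥0∞) (x y : Γ) :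
    ∑' z, m (x⁻¹ * z) * GE m z y ≤ GE m x y := by
  have := PE_GE_le m 1 x y
  simpa only [PE_one] using this

theorem HH_in (m : Γ → ℝ≥0∞) (W : Set Γ) (x : Γ) (hx : x ∈ W) (f : Γ → ℝ≥0∞) :
    ∑' v, HH m W x v * f v = f x := by
  have h1 : ∀ v, HH m W x v = HT m W 0 x v := by
    intro v
    rw [HH, tsum_eq_single 0]
    intro k hk
    obtain ⟨k, rfl⟩ := Nat.exists_eq_succ_of_ne_zero hk
    simp [HT, hx]
  simp_rw [h1]
  rw [tsum_eq_single x]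
  · simp [HT, hx]
  · intro b hb; simp [HT, Ne.symm hb]

theorem HH_out (m : Γ → ℝ≥0∞) (W : Set Γ) (x : Γ) (hx : x ∉ W) (f : Γ → ℝ≥0∞) :
    ∑' v, HH m W x v * f v = ∑' z, m (x⁻¹ * z) * ∑' v, HH m W z v * f v := by
  have h1 : ∀ v, HH m W x v = ∑' z, m (x⁻¹ * z) * HH m W z v := by
    intro v
    unfold HH
    rw [tsum_eq_zero_add' ENNReal.summable]
    simp only [HT, hx, false_and, if_false, zero_add]
    rw [ENNReal.tsum_comm]
    simp_rw [ENNReal.tsum_mul_left]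
  simp_rw [h1, ← ENNReal.tsum_mul_right, ← ENNReal.tsum_mul_left]
  rw [ENNReal.tsum_comm]
  simp_rw [mul_assoc]

theorem HH_le (m : Γ → ℝ≥0∞) (W : Set Γ) (x y : Γ) :
    ∑' v, HH m W x v * GE m v y ≤ GE m x y := by
  have key : ∀ K : ℕ, ∀ x, ∑ k ∈ Finset.range K, ∑' v, HT m W k x v * GE m v y ≤ GE m x y := by
    intro K
    induction K with
    | zero => simp
    | succ K ih =>
      intro x
      by_cases hx : x ∈ W
      · refine le_trans ?_ (HH_in m W x hx (fun v => GE m v y)).le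
        unfold HH
        simp_rw [← ENNReal.tsum_mul_right]
        rw [ENNReal.tsum_comm]
        exact ENNReal.sum_le_tsum _
      · rw [Finset.sum_range_succ']
        simp only [HT, hx, if_false, false_and, zero_mul, tsum_zero, add_zero]
        refine le_trans ?_ (GE_step m x y)
        simp_rw [← ENNReal.tsum_mul_right]
        calc _ = ∑ k ∈ Finset.range K, ∑' z, m (x⁻¹ * z) * ∑' v, HT m W k z v * GE m v y := by
              refine Finset.sum_congr rfl fun k _ => ?_
              rw [ENNReal.tsum_comm]
              simp_rw [mul_assoc, ENNReal.tsum_mul_left]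
          _ = ∑' z, m (x⁻¹ * z) * ∑ k ∈ Finset.range K, ∑' v, HT m W k z v * GE m v y := by
              simp_rw [Finset.mul_sum]
              rw [Summable.tsum_finsetSum fun _ _ => ENNReal.summable]
          _ ≤ _ := ENNReal.tsum_le_tsum fun z => by gcongr; exact ih z
  have : ∑' v, HH m W x v * GE m v y = ∑' k, ∑' v, HT m W k x v * GE m v y := by
    unfold HH
    simp_rw [← ENNReal.tsum_mul_right]
    rw [ENNReal.tsum_comm]
  rw [this, ENNReal.tsum_eq_iSup_nat]
  exact iSup_le fun K => key K x

theorem GE_le_HH (m : Γ → ℝ≥0∞) (W : Set Γ) (x y : Γ) :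
    GE m x y ≤ ∑' v, HH m W x v * GE m v y + ∑' n, AV m W n x y := by
  classical
  rw [GE, ENNReal.tsum_eq_iSup_nat]
  refine iSup_le fun N => ?_
  induction N generalizing x with
  | zero => simp
  | succ N ih =>
    by_cases hx : x ∈ W
    · rw [HH_in m W x hx (fun v => GE m v y)]
      exact (ENNReal.sum_le_tsum _).trans le_self_add
    · rw [HH_out m W x hx (fun v => GE m v y), Finset.sum_range_succ',
        tsum_eq_zero_add' (f := fun n => AV m W n x y) ENNReal.summable]
      simp only [AV, hx, if_false, not_false_eq_true, true_and]
      rw [ENNReal.tsum_comm]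
      simp_rw [PE_succ', ENNReal.tsum_mul_left]
      rw [← Summable.tsum_finsetSum fun _ _ => ENNReal.summable]
      simp_rw [← Finset.mul_sum]
      have h0 : PE m 0 x y = if x = y then 1 else 0 := by simp only [PE]
      rw [h0, add_comm (ite _ _ _), ← add_assoc, ← ENNReal.tsum_add]
      gcongr with z
      rw [← mul_add]
      gcongr
      exact ih z

/-! ### Detours are long -/

theorem Ch.split {S W : Set Γ} (a b : ℕ) {x y : Γ} (h : Ch S W (a + b) x y) :
    ∃ z, Ch S W a x z ∧ Ch S W b z y := by
  induction a generalizing x with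
  | zero =>
    rw [zero_add] at h
    refine ⟨x, ⟨?_, rfl⟩, h⟩
    cases b <;> exact h.1
  | succ a ih =>
    rw [add_right_comm] at h
    obtain ⟨h1, z, h2, h3⟩ := h
    obtain ⟨w, h4, h5⟩ := ih h3
    exact ⟨w, ⟨h1, z, h2, h4⟩, h5⟩

theorem Ch.gp {S : Set Γ} {δ : ℝ} (hS : IsGenSet S) (hδ : IsHyperbolic S δ) (z : Γ) (r : ℝ)
    (k : ℕ) : ∀ n ≤ 2 ^ k, ∀ x y, Ch S {w | ds S z w < r} n x y →
    r - 1 - k * δ ≤ gp S z x y := by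
  induction k with
  | zero =>
    intro n hn x y h
    rw [gp_trans, g1_eq hS, ds_mul]
    change _ ≤ (ds S z x + ds S z y - ds S x y) / 2
    push_cast
    interval_cases n
    · obtain ⟨h1, rfl⟩ := h
      rw [ds_self]
      have : r ≤ ds S z x := not_lt.1 h1
      linarith
    · obtain ⟨h1, w, h2, h3, rfl⟩ := h
      have e1 : r ≤ ds S z x := not_lt.1 h1
      have e2 : r ≤ ds S z w := not_lt.1 h3
      have e3 : ds S x w ≤ 1 := by unfold ds; exact_mod_cast wl_le_one h2
      linarith
  | succ k ih =>
    intro n hn x y h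
    have : n = n / 2 + (n - n / 2) := by omega
    rw [this] at h
    rw [pow_succ] at hn
    obtain ⟨w, h1, h2⟩ := Ch.split _ _ h
    have a1 := ih _ (by omega) _ _ h1
    have a2 := ih _ (by omega) _ _ h2
    have a3 := hypz hδ z (x := x) (y := y) w a1 (by
      rw [gp_trans, g1_comm hS, ← gp_trans]; exact a2)
    push_cast
    linarith



theorem numeric (c η a : ℝ) (hη0 : 0 < η) (hη1 : η < 1) (ha0 : 0 < a) (ha1 : a < 1)
    (D : ℕ) (hD : 0 < D) : ∃ R1 : ℕ, ∀ R ≥ R1, c * η ^ (2 ^ (R / D)) ≤ a ^ R := by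
  obtain ⟨j, hj⟩ := exists_pow_lt_of_lt_one (pow_pos ha0 D) hη1
  obtain ⟨l, hl⟩ := exists_pow_lt_of_lt_one (show (0:ℝ) < 1 / (|c| + 1) by positivity) hη1
  have hK : ∃ K : ℕ, ∀ k ≥ K, j * (k + 1) + l ≤ 2 ^ k := by
    have h1 := tendsto_pow_const_div_const_pow_of_one_lt 1 (show (1:ℝ) < 2 by norm_num)
    have h2 := (h1.const_mul ((j : ℝ))).add ((tendsto_pow_atTop_nhds_zero_of_lt_one (r := (1/2:ℝ))
      (by norm_num) (by norm_num)).const_mul ((j : ℝ) + l))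
    simp only [mul_zero, add_zero] at h2
    obtain ⟨K, hK⟩ := eventually_atTop.1 (h2.eventually (gt_mem_nhds zero_lt_one))
    refine ⟨K, fun k hk => ?_⟩
    have := hK k hk
    have e : (j : ℝ) * ((k:ℝ) ^ 1 / 2 ^ k) + (j + l) * (1 / 2) ^ k = (j * (k + 1) + l) / 2 ^ k := by
      rw [one_div, inv_pow]; ring
    rw [e, div_lt_one (by positivity)] at this
    exact_mod_cast this.le
  obtain ⟨K, hK⟩ := hK
  refine ⟨D * K, fun R hR => ?_⟩
  set k := R / D with hk
  have hk1 : K ≤ k := by rw [hk, Nat.le_div_iff_mul_le hD]; linarith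
  have hk2 : R ≤ D * (k + 1) := by
    have := Nat.lt_mul_div_succ R hD
    exact this.le
  calc c * η ^ (2 ^ k) ≤ (|c| + 1) * η ^ (2 ^ k) := by
        gcongr; linarith [le_abs_self c]
    _ ≤ (|c| + 1) * η ^ (j * (k + 1) + l) := by
        gcongr (|c| + 1) * ?_
        exact pow_le_pow_of_le_one hη0.le hη1.le (hK k hk1)
    _ = ((|c| + 1) * η ^ l) * (η ^ j) ^ (k + 1) := by rw [pow_add, pow_mul]; ring
    _ ≤ 1 * (a ^ D) ^ (k + 1) := by
        gcongr
        · have := hl.le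
          rw [le_div_iff₀ (by positivity)] at this
          linarith
    _ = a ^ (D * (k + 1)) := by rw [one_mul, pow_mul]
    _ ≤ a ^ R := pow_le_pow_of_le_one ha0.le ha1.le hk2

theorem barrier {S : Set Γ} {δ : ℝ} {m : Γ → ℝ≥0∞} (hS : IsGenSet S) (hδ : IsHyperbolic S δ)
    (h : Walk S m) (hfin : ∀ x y, GE m x y ≠ ⊤) {c η : ℝ} (hc : 0 ≤ c) (hη0 : 0 < η) (hη1 : η < 1)
    (hdec : ∀ n x y, PE m n x y ≤ ENNReal.ofReal (c * η ^ n)) (C : ℝ) :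
    ∃ R1 : ℕ, ∀ x, R1 ≤ wl S x → ∃ hh : Γ → ℝ≥0∞,
      (∀ v, hh v ≠ 0 → wl S v < wl S x ∧
        ∀ x0, (wl S x : ℝ) / 2 ≤ g1 S x x0 → (wl S v : ℝ) / 2 ≤ g1 S v x0) ∧
      (∀ y, ∑' v, hh v * GE m v y ≤ GE m x y) ∧
      ∀ y, wl S y ≤ wl S x → g1 S x y ≤ C →
        GE m x y ≤ ENNReal.ofReal (Real.exp (2 * (1 / 2) ^ wl S x)) * ∑' v, hh v * GE m v y := by
  have hδ0 := hδ.1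
  obtain ⟨κ, k0, k1, -, k2⟩ := harnack hS h
  have kt : κ ≠ ⊤ := (k1.trans_lt ENNReal.one_lt_top).ne
  obtain ⟨κr, hκr⟩ : ∃ κr : ℝ, κr = κ.toReal := ⟨_, rfl⟩
  have hκ0 : 0 < κr := by rw [hκr]; exact ENNReal.toReal_pos k0 kt
  have hκ1 : κr ≤ 1 := by
    rw [hκr]; exact ENNReal.toReal_le_of_le_ofReal zero_le_one (by simpa using k1)
  have hκ : κ = ENNReal.ofReal κr := by rw [hκr, ENNReal.ofReal_toReal kt]
  obtain ⟨D, hD⟩ := exists_nat_ge (δ + 1)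
  have hD0 : 0 < D := by
    have : (0:ℝ) < D := by linarith
    exact_mod_cast this
  obtain ⟨R1, hR1⟩ := numeric (c / (1 - η)) η (κr ^ 2 / 2) hη0 hη1 (by positivity)
    (by nlinarith) (32 * D) (by omega)
  obtain ⟨R2, hR2⟩ := exists_nat_ge (32 * (δ + 1) + 2 * |C| + 8 * δ + 8)
  refine ⟨R1 + R2, fun x hx => ?_⟩
  set R := wl S x with hR
  obtain ⟨z, hz1, hz2⟩ := exists_start_seg hS x (R / 2) (by omega)
  have hRr : 32 * (δ + 1) + 2 * |C| + 8 * δ + 8 ≤ (R : ℝ) := by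
    refine hR2.trans ?_
    exact_mod_cast (by omega : R2 ≤ R)
  have hL1 : ((R / 2 : ℕ) : ℝ) ≤ R / 2 := Nat.cast_div_le
  have hL2 : (R : ℝ) / 2 - 1 / 2 ≤ ((R / 2 : ℕ) : ℝ) := by
    have : R ≤ 2 * (R / 2) + 1 := by omega
    have : (R : ℝ) ≤ 2 * ((R / 2 : ℕ) : ℝ) + 1 := by exact_mod_cast this
    linarith
  set L := R / 2 with hL
  have hzx : ds S z x = R - L := by
    unfold ds; rw [hz2, hR]; push_cast [(by omega : L ≤ wl S x)]; ring
  have hg1zx : g1 S z x = L := by rw [g1_eq hS, hzx, hz1, ← hR]; ring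
  set W : Set Γ := {w | ds S z w < (R : ℝ) / 16} with hW
  set k := R / (32 * D) with hk
  have hkr : (k : ℝ) * δ ≤ R / 32 := by
    have h1 : k * (32 * D) ≤ R := Nat.div_mul_le_self _ _
    have h1 : (k : ℝ) * (32 * D) ≤ R := by exact_mod_cast h1
    have h2 : (k : ℝ) * δ ≤ k * D := by gcongr; linarith
    linarith
  refine ⟨HH m W x, fun v hv => ?_, HH_le m W x, fun y hy hxy => ?_⟩
  · have hv : ds S z v < (R : ℝ) / 16 := HH_supp m W x v hv
    have e1 := ds_tri hS 1 z v
    rw [ds_one, ds_one, hz1] at e1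
    refine ⟨?_, fun x0 hx0 => ?_⟩
    · have : (wl S v : ℝ) < R := by linarith [abs_nonneg C]
      exact_mod_cast this
    · have e2 := hyp' hS hδ (a := (L : ℝ)) (x := z) (y := x0) x hg1zx.ge (by linarith)
      have e3 := g1_lip hS z v x0
      linarith [abs_nonneg C]
  · -- no short detour
    have hC := le_abs_self C
    have hyz : g1 S y z ≤ C + δ := hyp_small hδ z hxy (by rw [g1_comm hS, hg1zx]; linarith)
    have hno : ∀ n < 2 ^ k, AV m W n x y = 0 := by
      intro n hn
      by_contra h0
      have a1 := Ch.gp hS hδ z (R / 16) k n hn.le x y (AV_chain h W n x y h0)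
      have e2 : gp S z y 1 = L - g1 S y z := by
        rw [gp_trans, g1_eq hS, g1_eq hS, ds_mul, ds_one' hS, mul_one, wl_inv hS, hz1,
          ds_comm hS y z]
        unfold ds; ring
      have e3 : gp S z x 1 = 0 := by
        rw [gp_trans, g1_eq hS, ds_mul, ds_one' hS, mul_one, wl_inv hS, hz1, hz2]
        push_cast [(by omega : L ≤ wl S x)]; ring
      have e4 := hypz hδ z (x := x) (y := 1) y (a := min (R / 16 - 1 - k * δ) (L - C - δ))
        ((min_le_left _ _).trans a1) ((min_le_right _ _).trans (by
          rw [gp_trans, g1_comm hS, ← gp_trans, e2]; linarith))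
      rw [e3] at e4
      rcases min_cases ((R : ℝ) / 16 - 1 - k * δ) (L - C - δ) with ⟨e, -⟩ | ⟨e, -⟩ <;>
        rw [e] at e4 <;> linarith [neg_abs_le C]
    have hsum : ∑' n, AV m W n x y ≤ ENNReal.ofReal (c / (1 - η) * η ^ (2 ^ k)) := by
      have e1 : ∑' n, AV m W n x y = ∑' n, AV m W (n + 2 ^ k) x y := by
        rw [← Summable.sum_add_tsum_nat_add' (k := 2 ^ k) ENNReal.summable,
          Finset.sum_eq_zero fun n hn => hno n (Finset.mem_range.1 hn), zero_add]
      have hs := (summable_geometric_of_lt_one hη0.le hη1).mul_left (c * η ^ (2 ^ k))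
      rw [e1]
      calc _ ≤ ∑' n : ℕ, ENNReal.ofReal (c * η ^ (2 ^ k) * η ^ n) := by
            refine ENNReal.tsum_le_tsum fun n => (AV_le m W _ x y).trans ((hdec _ x y).trans ?_)
            rw [pow_add, mul_comm (η ^ n), mul_assoc]
        _ = ENNReal.ofReal (∑' n : ℕ, c * η ^ (2 ^ k) * η ^ n) :=
            (ENNReal.ofReal_tsum_of_nonneg (fun n => by positivity) hs).symm
        _ = _ := by
            rw [tsum_mul_left, tsum_geometric_of_lt_one hη0.le hη1]; congr 1; field_simp
    have hxyd : wl S (x⁻¹ * y) ≤ 2 * R := by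
      have := wl_mul_le hS x⁻¹ y
      rw [wl_inv hS] at this
      omega
    have hsum2 : ∑' n, AV m W n x y ≤ ENNReal.ofReal ((1 / 2) ^ R) * GE m x y := by
      calc _ ≤ _ := hsum
        _ ≤ ENNReal.ofReal ((κr ^ 2 / 2) ^ R) := ENNReal.ofReal_le_ofReal (hR1 R (by omega))
        _ = ENNReal.ofReal ((1 / 2) ^ R) * κ ^ (2 * R) := by
            rw [hκ, ← ENNReal.ofReal_pow hκ0.le, ← ENNReal.ofReal_mul (by positivity)]
            congr 1
            rw [pow_mul, ← mul_pow]; congr 1; ring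
        _ ≤ _ := by
            gcongr
            exact (pow_le_pow_right_of_le_one' k1 hxyd).trans (k2 x y)
    have hmain := (GE_le_HH m W x y).trans (add_le_add_right hsum2 _)
    have hHt : ∑' v, HH m W x v * GE m v y ≠ ⊤ :=
      ((HH_le m W x y).trans_lt (hfin x y).lt_top).ne
    set G := GE m x y with hG
    set H := ∑' v, HH m W x v * GE m v y with hH
    have hGt := hfin x y
    rw [← hG] at hGt
    set t : ℝ := (1 / 2) ^ R with ht
    have ht0 : 0 < t := by positivity
    have ht1 : t ≤ 1 / 2 := by
      have : 1 ≤ R := by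
        have : (0:ℝ) < R := by linarith [abs_nonneg C]
        exact_mod_cast this
      calc t ≤ (1 / 2) ^ 1 := pow_le_pow_of_le_one (by norm_num) (by norm_num) this
        _ = _ := by norm_num
    rw [← ENNReal.ofReal_toReal hGt, ← ENNReal.ofReal_toReal hHt] at hmain ⊢
    have hG0 : 0 ≤ G.toReal := ENNReal.toReal_nonneg
    have hH0 : 0 ≤ H.toReal := ENNReal.toReal_nonneg
    rw [← ENNReal.ofReal_mul ht0.le, ← ENNReal.ofReal_add hH0 (by positivity),
      ENNReal.ofReal_le_ofReal_iff (by positivity)] at hmain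
    rw [← ENNReal.ofReal_mul (Real.exp_pos _).le]
    refine ENNReal.ofReal_le_ofReal ?_
    have e1 : 2 * t + 1 ≤ Real.exp (2 * t) := Real.add_one_le_exp _
    calc G.toReal ≤ (2 * t + 1) * ((1 - t) * G.toReal) := by
          nlinarith [mul_nonneg (mul_nonneg ht0.le (sub_nonneg.2 ht1)) hG0]
      _ ≤ (2 * t + 1) * H.toReal := by gcongr; linarith
      _ ≤ _ := by gcongr



theorem ofReal_exp_add (a b : ℝ) : ENNReal.ofReal (Real.exp (a + b)) =
    ENNReal.ofReal (Real.exp a) * ENNReal.ofReal (Real.exp b) := by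
  rw [Real.exp_add, ENNReal.ofReal_mul (Real.exp_pos _).le]

theorem ofReal_exp_mono {a b : ℝ} (h : a ≤ b) : ENNReal.ofReal (Real.exp a) ≤
    ENNReal.ofReal (Real.exp b) := ENNReal.ofReal_le_ofReal (Real.exp_le_exp.2 h)

theorem cone_le {S : Set Γ} {δ C : ℝ} (hS : IsGenSet S) (hδ : IsHyperbolic S δ) {x w y0 : Γ}
    (h1 : g1 S x y0 ≤ C) (h2 : (wl S w : ℝ) / 2 ≤ g1 S w y0) : g1 S x w ≤ 2 * C + 2 * δ := by
  by_contra hc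
  push Not at hc
  have h0 := hδ.1
  have hC : 0 ≤ C := (g1_nonneg hS _ _).trans h1
  have h3 := g1_le_right hS x w
  have h5 := hyp' hS hδ (a := min (g1 S x w) (g1 S w y0)) (x := x) (y := y0) w
    (min_le_left _ _) (min_le_right _ _)
  rcases min_cases (g1 S x w) (g1 S w y0) with ⟨e, -⟩ | ⟨e, -⟩ <;> rw [e] at h5 <;> linarith

theorem half_mono {a b : ℕ} (h : a ≤ b) : ((1:ℝ) / 2) ^ b ≤ (1 / 2) ^ a :=
  pow_le_pow_of_le_one (by norm_num) (by norm_num) h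

theorem barrier2 {S : Set Γ} {δ : ℝ} {m : Γ → ℝ≥0∞} (hS : IsGenSet S) (hδ : IsHyperbolic S δ)
    (h : Walk S m) (hfin : ∀ x y, GE m x y ≠ ⊤) {c η : ℝ} (hc : 0 ≤ c) (hη0 : 0 < η) (hη1 : η < 1)
    (hdec : ∀ n x y, PE m n x y ≤ ENNReal.ofReal (c * η ^ n)) (C : ℝ) :
    ∃ R1 : ℕ, ∀ x, R1 ≤ wl S x → ∃ hh : Γ → ℝ≥0∞,
      (∀ v, hh v ≠ 0 → wl S v < wl S x ∧
        ∀ x0, (wl S x : ℝ) / 2 ≤ g1 S x x0 → (wl S v : ℝ) / 2 ≤ g1 S v x0) ∧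
      (∀ y, ∑' v, hh v * GE m v y ≤ GE m x y) ∧
      ∀ y, g1 S x y ≤ C →
        GE m x y ≤ ENNReal.ofReal (Real.exp (4 * (1 / 2) ^ wl S x)) * ∑' v, hh v * GE m v y := by
  obtain ⟨Ra, hRa⟩ := barrier hS hδ h hfin hc hη0 hη1 hdec (2 * C + 2 * δ)
  obtain ⟨Rb, hRb⟩ := barrier hS hδ (h.rev hS) (fun x y => by rw [GE_rev]; exact hfin y x)
    hc hη0 hη1 (fun n x y => by rw [PE_rev]; exact hdec n y x) (2 * C + 2 * δ)
  refine ⟨max Ra Rb, fun x hx => ?_⟩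
  obtain ⟨hh, h1, h2, h3⟩ := hRa x ((le_max_left _ _).trans hx)
  refine ⟨hh, h1, h2, fun y0 hy0 => ?_⟩
  set R := wl S x with hR
  have key : ∀ n : ℕ, ∀ y, wl S y = n → (wl S y : ℝ) / 2 ≤ g1 S y y0 →
      GE m x y ≤ ENNReal.ofReal (Real.exp (4 * (1 / 2) ^ R - 2 * (1 / 2) ^ max n R)) *
        ∑' v, hh v * GE m v y := by
    intro n
    induction n using Nat.strong_induction_on with
    | _ n ih =>
      intro y hy hcone
      have hxy := cone_le hS hδ hy0 hcone
      rcases le_or_gt n R with hn | hn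
      · refine (h3 y (by omega) hxy).trans ?_
        refine mul_le_mul' (ofReal_exp_mono ?_) le_rfl
        rw [max_eq_right hn]; linarith
      · obtain ⟨h', a1, a2, a3⟩ := hRb y (by rw [hy]; exact ((le_max_right _ _).trans hx).trans hn.le)
        have b := a3 x (by omega) (by rw [g1_comm hS]; exact hxy)
        simp_rw [GE_rev] at a2 b
        have hpt : ∀ w, h' w * GE m x w ≤
            h' w * (ENNReal.ofReal (Real.exp (4 * (1 / 2) ^ R - 4 * (1 / 2) ^ n)) *
              ∑' v, hh v * GE m v w) := by
          intro w
          by_cases hw : h' w = 0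
          · simp [hw]
          obtain ⟨w1, w2⟩ := a1 w hw
          refine mul_le_mul' le_rfl ?_
          refine (ih (wl S w) (by omega) w rfl (w2 y0 hcone)).trans ?_
          refine mul_le_mul' (ofReal_exp_mono ?_) le_rfl
          have e1 := half_mono (a := max (wl S w) R) (b := n - 1) (by omega)
          have e2 : ((1:ℝ) / 2) ^ (n - 1) = 2 * (1 / 2) ^ n := by
            obtain ⟨n, rfl⟩ := Nat.exists_eq_succ_of_ne_zero (by omega : n ≠ 0)
            rw [Nat.succ_sub_one, pow_succ]; ring
          linarith
        calc GE m x y ≤ _ := b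
          _ ≤ ENNReal.ofReal (Real.exp (2 * (1 / 2) ^ wl S y)) * ∑' w,
              h' w * (ENNReal.ofReal (Real.exp (4 * (1 / 2) ^ R - 4 * (1 / 2) ^ n)) *
              ∑' v, hh v * GE m v w) := mul_le_mul' le_rfl (ENNReal.tsum_le_tsum hpt)
          _ = ENNReal.ofReal (Real.exp (4 * (1 / 2) ^ R - 2 * (1 / 2) ^ max n R)) *
              ∑' w, h' w * ∑' v, hh v * GE m v w := by
              simp_rw [mul_left_comm (h' _), ENNReal.tsum_mul_left]
              rw [← mul_assoc, ← ofReal_exp_add, max_eq_left hn.le, hy]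
              congr 3; ring
          _ = ENNReal.ofReal (Real.exp (4 * (1 / 2) ^ R - 2 * (1 / 2) ^ max n R)) *
              ∑' v, hh v * ∑' w, h' w * GE m v w := by
              simp_rw [← ENNReal.tsum_mul_left]
              rw [ENNReal.tsum_comm]
              simp_rw [mul_left_comm (h' _)]
          _ ≤ _ := by
              gcongr with v
              exact a2 v
  refine (key _ y0 rfl ?_).trans ?_
  · rw [g1_self hS]
    have : (0:ℝ) ≤ wl S y0 := Nat.cast_nonneg _
    linarith
  · refine mul_le_mul' (ofReal_exp_mono ?_) le_rfl
    have : (0:ℝ) < (1/2) ^ max (wl S y0) R := by positivity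
    linarith

theorem ratio_ind {S : Set Γ} {δ : ℝ} {m : Γ → ℝ≥0∞} (hS : IsGenSet S) (hδ : IsHyperbolic S δ)
    (h : Walk S m) (hfin : ∀ x y, GE m x y ≠ ⊤) {c η : ℝ} (hc : 0 ≤ c) (hη0 : 0 < η) (hη1 : η < 1)
    (hdec : ∀ n x y, PE m n x y ≤ ENNReal.ofReal (c * η ^ n)) (C : ℝ) :
    ∃ R1 : ℕ, ∀ R0 ≥ R1, ∀ (ε : ℝ) (x0 y y' : Γ), g1 S x0 y ≤ C → g1 S x0 y' ≤ C →
      (∀ v, wl S v ≤ R0 → GE m v y * GE m 1 y' ≤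
        ENNReal.ofReal (Real.exp ε) * (GE m v y' * GE m 1 y)) →
      GE m x0 y * GE m 1 y' ≤
        ENNReal.ofReal (Real.exp (ε + 4 * (1 / 2) ^ R0)) * (GE m x0 y' * GE m 1 y) := by
  obtain ⟨R1, hR1⟩ := barrier2 hS hδ h hfin hc hη0 hη1 hdec (2 * C + 2 * δ)
  refine ⟨R1, fun R0 hR0 ε x0 y y' hy hy' base => ?_⟩
  have key : ∀ n : ℕ, ∀ v, wl S v = n → (wl S v : ℝ) / 2 ≤ g1 S v x0 →
      GE m v y * GE m 1 y' ≤
        ENNReal.ofReal (Real.exp (ε + 4 * (1 / 2) ^ R0 - 4 * (1 / 2) ^ max n R0)) *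
          (GE m v y' * GE m 1 y) := by
    intro n
    induction n using Nat.strong_induction_on with
    | _ n ih =>
      intro v hv hcone
      rcases le_or_gt n R0 with hn | hn
      · refine (base v (by omega)).trans ?_
        refine mul_le_mul' (ofReal_exp_mono ?_) le_rfl
        rw [max_eq_right hn]; linarith
      · have hvy := cone_le hS hδ (x := y) (C := C) (by rw [g1_comm hS]; exact hy) hcone
        obtain ⟨hh, a1, a2, a3⟩ := hR1 v (by omega)
        have b := a3 y (by rw [g1_comm hS]; exact hvy)
        have hpt : ∀ w, hh w * (GE m w y * GE m 1 y') ≤ hh w *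
            (ENNReal.ofReal (Real.exp (ε + 4 * (1 / 2) ^ R0 - 8 * (1 / 2) ^ n)) *
              (GE m w y' * GE m 1 y)) := by
          intro w
          by_cases hw : hh w = 0
          · simp [hw]
          obtain ⟨w1, w2⟩ := a1 w hw
          refine mul_le_mul' le_rfl ?_
          refine (ih (wl S w) (by omega) w rfl (w2 x0 hcone)).trans ?_
          refine mul_le_mul' (ofReal_exp_mono ?_) le_rfl
          have e1 := half_mono (a := max (wl S w) R0) (b := n - 1) (by omega)
          have e2 : ((1:ℝ) / 2) ^ (n - 1) = 2 * (1 / 2) ^ n := by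
            obtain ⟨n, rfl⟩ := Nat.exists_eq_succ_of_ne_zero (by omega : n ≠ 0)
            rw [Nat.succ_sub_one, pow_succ]; ring
          linarith
        calc GE m v y * GE m 1 y' ≤ (ENNReal.ofReal (Real.exp (4 * (1 / 2) ^ wl S v)) *
              ∑' w, hh w * GE m w y) * GE m 1 y' := by gcongr
          _ = ENNReal.ofReal (Real.exp (4 * (1 / 2) ^ wl S v)) *
              ∑' w, hh w * (GE m w y * GE m 1 y') := by
              rw [mul_assoc, ← ENNReal.tsum_mul_right]; simp_rw [mul_assoc]
          _ ≤ ENNReal.ofReal (Real.exp (4 * (1 / 2) ^ wl S v)) * ∑' w, hh w *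
            (ENNReal.ofReal (Real.exp (ε + 4 * (1 / 2) ^ R0 - 8 * (1 / 2) ^ n)) *
              (GE m w y' * GE m 1 y)) := mul_le_mul' le_rfl (ENNReal.tsum_le_tsum hpt)
          _ = ENNReal.ofReal (Real.exp (ε + 4 * (1 / 2) ^ R0 - 4 * (1 / 2) ^ max n R0)) *
              ((∑' w, hh w * GE m w y') * GE m 1 y) := by
              simp_rw [mul_left_comm (hh _), ENNReal.tsum_mul_left]
              rw [← mul_assoc, ← ofReal_exp_add, max_eq_left hn.le, hv, ← ENNReal.tsum_mul_right]
              congr 1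
              · congr 2; ring
              · exact tsum_congr fun w => by ring
          _ ≤ _ := by gcongr; exact a2 y'
  refine (key _ x0 rfl ?_).trans ?_
  · rw [g1_self hS]
    have : (0:ℝ) ≤ wl S x0 := Nat.cast_nonneg _
    linarith
  · refine mul_le_mul' (ofReal_exp_mono ?_) le_rfl
    have : (0:ℝ) < (1/2) ^ max (wl S x0) R0 := by positivity
    linarith



/-! ### The Martin kernel on the boundary -/

structure Ctx (S : Set Γ) (δ : ℝ) (μ : Γ → ℝ) (B : Boundary Γ S) (Kb : Γ → B.pt → ℝ) : Prop where
  hS : IsGenSet S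
  hδ : IsHyperbolic S δ
  hne : Nonelementary Γ
  hμ : IsRWMeasure S μ
  hKb : ∀ (x : Γ) (ξ : B.pt) (u : ℕ → Γ), ConvInf S u → B.cls u = ξ →
      Tendsto (fun n => martinK μ x (u n)) atTop (𝓝 (Kb x ξ))
  hfin : ∀ x y, GE (mE μ) x y ≠ ⊤

section
variable {S : Set Γ} {δ : ℝ} {μ : Γ → ℝ} {B : Boundary Γ S} {Kb : Γ → B.pt → ℝ}

theorem Ctx.green_pos (H : Ctx S δ μ B Kb) (x y : Γ) : 0 < green μ x y := by
  rw [green_eq H.hμ]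
  exact ENNReal.toReal_pos (GE_pos (walk_mE H.hμ) x y) (H.hfin x y)

theorem Ctx.green_mul (H : Ctx S δ μ B Kb) (g x y : Γ) :
    green μ (g * x) (g * y) = green μ x y := by
  rw [green_eq H.hμ, green_eq H.hμ, GE_mul]

theorem Ctx.mk_pos (H : Ctx S δ μ B Kb) (x y : Γ) : 0 < martinK μ x y :=
  div_pos (H.green_pos _ _) (H.green_pos _ _)

theorem Ctx.mk_one (H : Ctx S δ μ B Kb) (y : Γ) : martinK μ 1 y = 1 :=
  div_self (H.green_pos _ _).ne'

theorem Ctx.mk_mul (H : Ctx S δ μ B Kb) (g h y : Γ) :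
    martinK μ (g * h) y = martinK μ g y * martinK μ h (g⁻¹ * y) := by
  have h1 := H.green_mul g h (g⁻¹ * y)
  have h2 := H.green_mul g 1 (g⁻¹ * y)
  rw [mul_inv_cancel_left] at h1 h2
  rw [mul_one] at h2
  unfold martinK
  rw [← h1, ← h2]
  have := (H.green_pos g y).ne'
  have := (H.green_pos 1 y).ne'
  field_simp

theorem Ctx.harnack (H : Ctx S δ μ B Kb) :
    ∃ κ : ℝ, 0 < κ ∧ ∀ x y, κ ^ wl S x ≤ martinK μ x y := by
  obtain ⟨κ, k0, k1, k2, -⟩ := HarmonicBoundary.harnack H.hS (walk_mE H.hμ)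
  have kt : κ ≠ ⊤ := (k1.trans_lt ENNReal.one_lt_top).ne
  refine ⟨κ.toReal, ENNReal.toReal_pos k0 kt, fun x y => ?_⟩
  have := k2 x 1 y
  rw [mul_one, wl_inv H.hS] at this
  have := ENNReal.toReal_mono (H.hfin _ _) this
  rw [ENNReal.toReal_mul, ENNReal.toReal_pow, ← green_eq H.hμ, ← green_eq H.hμ] at this
  rw [martinK, le_div_iff₀ (H.green_pos _ _)]
  exact this

theorem Ctx.Kb_pos (H : Ctx S δ μ B Kb) (x : Γ) (ξ : B.pt) : 0 < Kb x ξ := by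
  obtain ⟨κ, h0, h⟩ := H.harnack
  obtain ⟨u, hu, rfl⟩ := B.cls_surj ξ
  exact (pow_pos h0 _).trans_le (ge_of_tendsto' (H.hKb x _ u hu rfl) fun n => h x _)

theorem Ctx.Kb_one (H : Ctx S δ μ B Kb) (ξ : B.pt) : Kb 1 ξ = 1 := by
  obtain ⟨u, hu, rfl⟩ := B.cls_surj ξ
  have := H.hKb 1 _ u hu rfl
  simp_rw [H.mk_one] at this
  exact tendsto_nhds_unique this tendsto_const_nhds

theorem Ctx.Kb_mul (H : Ctx S δ μ B Kb) (g h : Γ) (ξ : B.pt) :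
    Kb (g * h) ξ = Kb g ξ * Kb h (B.smul g⁻¹ ξ) := by
  obtain ⟨u, hu, rfl⟩ := B.cls_surj ξ
  have h1 := H.hKb (g * h) _ u hu rfl
  have h2 := H.hKb g _ u hu rfl
  have h3 := H.hKb h _ _ (hu.mul H.hS g⁻¹) (B.smul_cls g⁻¹ u hu).symm
  simp_rw [H.mk_mul] at h1
  exact tendsto_nhds_unique h1 (h2.mul h3)

theorem Ctx.smul_mul (H : Ctx S δ μ B Kb) (g h : Γ) (ξ : B.pt) :
    B.smul (g * h) ξ = B.smul g (B.smul h ξ) := by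
  obtain ⟨u, hu, rfl⟩ := B.cls_surj ξ
  rw [B.smul_cls _ _ hu, B.smul_cls _ _ hu, B.smul_cls _ _ (hu.mul H.hS h)]
  simp_rw [mul_assoc]

theorem Ctx.smul_one (H : Ctx S δ μ B Kb) (ξ : B.pt) : B.smul 1 ξ = ξ := by
  obtain ⟨u, hu, rfl⟩ := B.cls_surj ξ
  rw [B.smul_cls _ _ hu]; simp

theorem Ctx.Kb_inv (H : Ctx S δ μ B Kb) (g : Γ) (ξ : B.pt) :
    Kb g ξ * Kb g⁻¹ (B.smul g⁻¹ ξ) = 1 := by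
  rw [← H.Kb_mul, mul_inv_cancel, H.Kb_one]

theorem Ctx.equiv_of_ev (H : Ctx S δ μ B Kb) {z v : ℕ → Γ} (hv : ConvInf S v)
    (h : ∀ N : ℝ, ∀ᶠ n in atTop, ∀ᶠ j in atTop, N ≤ g1 S (z n) (v j)) : EquivSeq S z v := by
  rw [equivSeq_iff]
  intro N
  obtain ⟨n0, h0⟩ := eventually_atTop.1 (h (N + δ))
  obtain ⟨n1, h1⟩ := convInf_iff.1 hv (N + δ)
  refine ⟨max n0 n1, fun i hi j hj => ?_⟩
  obtain ⟨n2, h2⟩ := eventually_atTop.1 (h0 i ((le_max_left _ _).trans hi))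
  have := hyp' H.hS H.hδ (v (max n1 n2)) (h2 _ (le_max_right _ _))
    (h1 _ (le_max_left _ _) j ((le_max_right _ _).trans hj))
  linarith

theorem Ctx.seq (H : Ctx S δ μ B Kb) {v : ℕ → Γ} (hv : ConvInf S v) {u : ℕ → ℕ → Γ}
    (hu : ∀ n, ConvInf S (u n))
    (h : ∀ N : ℝ, ∀ᶠ n in atTop, ∀ᶠ i in atTop, ∀ᶠ j in atTop, N ≤ g1 S (u n i) (v j)) (x : Γ) :
    Tendsto (fun n => Kb x (B.cls (u n))) atTop (𝓝 (Kb x (B.cls v))) := by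
  have hi : ∀ n : ℕ, ∃ i : ℕ, |martinK μ x (u n i) - Kb x (B.cls (u n))| < 1 / ((n:ℝ) + 1) ∧
      ∀ N ∈ Finset.range (n + 1), (∀ᶠ i in atTop, ∀ᶠ j in atTop, (N : ℝ) ≤ g1 S (u n i) (v j)) →
        ∀ᶠ j in atTop, (N : ℝ) ≤ g1 S (u n i) (v j) := by
    intro n
    have a1 := (Metric.tendsto_nhds.1 (H.hKb x _ (u n) (hu n) rfl)) (1 / ((n:ℝ) + 1)) (by positivity)
    have a2 : ∀ᶠ i in atTop, ∀ N ∈ Finset.range (n + 1),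
        (∀ᶠ i in atTop, ∀ᶠ j in atTop, (N : ℝ) ≤ g1 S (u n i) (v j)) →
        ∀ᶠ j in atTop, (N : ℝ) ≤ g1 S (u n i) (v j) := by
      rw [eventually_all_finset]
      intro N _
      by_cases hE : ∀ᶠ i in atTop, ∀ᶠ j in atTop, (N : ℝ) ≤ g1 S (u n i) (v j)
      · exact hE.mono fun i hi _ => hi
      · exact Eventually.of_forall fun i hi => absurd hi hE
    obtain ⟨i, b1, b2⟩ := (a1.and a2).exists
    exact ⟨i, by simpa [Real.dist_eq] using b1, b2⟩
  choose i hi1 hi2 using hi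
  have heq : EquivSeq S (fun n => u n (i n)) v := by
    refine H.equiv_of_ev hv fun N => ?_
    obtain ⟨N', hN'⟩ := exists_nat_ge N
    filter_upwards [h N', eventually_ge_atTop N'] with n hn1 hn2
    exact (hi2 n N' (Finset.mem_range.2 (by omega)) hn1).mono fun j hj => hN'.trans hj
  have hc := ConvInf.of_equiv H.hS H.hδ heq
  have h1 := H.hKb x _ _ hc ((B.cls_eq _ _ hc hv).2 heq)
  have h2 : Tendsto (fun n => Kb x (B.cls (u n)) - martinK μ x (u n (i n))) atTop (𝓝 0) := by
    refine squeeze_zero_norm (fun n => ?_) tendsto_one_div_add_atTop_nhds_zero_nat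
    rw [Real.norm_eq_abs, abs_sub_comm]
    exact (hi1 n).le
  simpa using h2.add h1

theorem Ctx.comp (H : Ctx S δ μ B Kb) (q : ℕ → B.pt) :
    ∃ φ : ℕ → ℕ, StrictMono φ ∧ ∃ p : B.pt,
      ∀ x, Tendsto (fun n => Kb x (q (φ n))) atTop (𝓝 (Kb x p)) := by
  have hz : ∀ n : ℕ, ∃ z : Γ, n ≤ wl S z ∧
      ∀ x ∈ {g | wl S g ≤ n}, |martinK μ x z - Kb x (q n)| < 1 / ((n:ℝ) + 1) := by
    intro n
    obtain ⟨u, hu, hq⟩ := B.cls_surj (q n)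
    obtain ⟨n0, hn0⟩ := hu.len H.hS n
    have a : ∀ᶠ i in atTop, ∀ x ∈ {g | wl S g ≤ n},
        |martinK μ x (u i) - Kb x (q n)| < 1 / ((n:ℝ) + 1) := by
      rw [eventually_all_finite (finite_ball H.hS n)]
      intro x _
      have := (Metric.tendsto_nhds.1 (H.hKb x _ u hu hq)) (1 / ((n:ℝ) + 1)) (by positivity)
      simpa only [Real.dist_eq] using this
    obtain ⟨i, b1, b2⟩ := (a.and (eventually_ge_atTop n0)).exists
    exact ⟨u i, by exact_mod_cast hn0 i b2, b1⟩
  choose z hz1 hz2 using hz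
  obtain ⟨φ, hφ, hc⟩ := exists_convInf_subseq H.hS z hz1
  refine ⟨φ, hφ, B.cls (z ∘ φ), fun x => ?_⟩
  have h1 := H.hKb x _ _ hc rfl
  have h2 : Tendsto (fun n => Kb x (q (φ n)) - martinK μ x (z (φ n))) atTop (𝓝 0) := by
    refine squeeze_zero_norm' ?_ (tendsto_one_div_add_atTop_nhds_zero_nat.comp hφ.tendsto_atTop)
    filter_upwards [eventually_ge_atTop (wl S x)] with n hn
    rw [Real.norm_eq_abs, abs_sub_comm]
    exact (hz2 (φ n) x (hn.trans (hφ.id_le n))).le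
  simpa using h2.add h1

theorem Ctx.unif (H : Ctx S δ μ B Kb) (R0 : ℕ) {ε : ℝ} (hε : 0 < ε) :
    ∃ M : ℝ, ∀ y y', M ≤ g1 S y y' → ∀ v, wl S v ≤ R0 →
      martinK μ v y ≤ Real.exp ε * martinK μ v y' := by
  by_contra hcon
  push Not at hcon
  have := fun n : ℕ => hcon n
  choose y y' h1 v h2 h3 using this
  obtain ⟨φ, hφ, hc⟩ := exists_convInf_subseq H.hS y (fun n => by
    have := (h1 n).trans (g1_le_left H.hS _ _)
    exact_mod_cast this)
  have heq : EquivSeq S (y' ∘ φ) (y ∘ φ) := by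
    rw [equivSeq_iff]
    intro N
    obtain ⟨n0, hn0⟩ := convInf_iff.1 hc (N + δ)
    obtain ⟨n1, hn1⟩ := exists_nat_ge (N + δ)
    refine ⟨max n0 n1, fun i hi j hj => ?_⟩
    simp only [ge_iff_le, max_le_iff] at hi hj
    have a2 : (n1 : ℝ) ≤ φ i := by exact_mod_cast hi.2.trans (hφ.id_le i)
    have a3 := h1 (φ i)
    rw [g1_comm H.hS] at a3
    have := hyp' H.hS H.hδ (a := N + δ) (y (φ i)) (x := y' (φ i)) (y := y (φ j)) (by linarith)
      (hn0 i hi.1 j hj.1)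
    simp only [Function.comp]
    linarith
  have hc' := ConvInf.of_equiv H.hS H.hδ heq
  have hev : ∀ᶠ n in atTop, ∀ v ∈ {g | wl S g ≤ R0},
      martinK μ v (y (φ n)) < Real.exp ε * martinK μ v (y' (φ n)) := by
    rw [eventually_all_finite (finite_ball H.hS R0)]
    intro v _
    have e1 := H.hKb v _ _ hc rfl
    have e2 := (H.hKb v _ _ hc' ((B.cls_eq _ _ hc' hc).2 heq)).const_mul (Real.exp ε)
    refine Tendsto.eventually_lt e1 e2 ?_
    have := H.Kb_pos v (B.cls (y ∘ φ))
    have : 1 < Real.exp ε := Real.one_lt_exp_iff.2 hε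
    nlinarith
  obtain ⟨n, hn⟩ := hev.exists
  have := hn (v (φ n)) (h2 _)
  linarith [h3 (φ n)]

def Decay (m : Γ → ℝ≥0∞) : Prop := ∃ c η : ℝ, 0 ≤ c ∧ 0 < η ∧ η < 1 ∧
  ∀ n x y, PE m n x y ≤ ENNReal.ofReal (c * η ^ n)

/-- Equicontinuity of the Martin kernel. -/
theorem Ctx.equi (H : Ctx S δ μ B Kb) (hd : Decay (mE μ)) (C : ℝ) {ε : ℝ} (hε : 0 < ε) :
    ∃ M : ℝ, ∀ x y y', g1 S x y ≤ C → g1 S x y' ≤ C → M ≤ g1 S y y' →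
      martinK μ x y ≤ Real.exp ε * martinK μ x y' := by
  obtain ⟨c, η, hc, hη0, hη1, hdec⟩ := hd
  obtain ⟨R1, hR1⟩ := ratio_ind H.hS H.hδ (walk_mE H.hμ) H.hfin hc hη0 hη1 hdec C
  obtain ⟨R2, hR2⟩ := exists_pow_lt_of_lt_one (show 0 < ε / 8 by positivity)
    (show (1/2:ℝ) < 1 by norm_num)
  obtain ⟨M, hM⟩ := H.unif (max R1 R2) (half_pos hε)
  have conv : ∀ (e : ℝ) (v y y' : Γ), martinK μ v y ≤ Real.exp e * martinK μ v y' ↔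
      GE (mE μ) v y * GE (mE μ) 1 y' ≤
        ENNReal.ofReal (Real.exp e) * (GE (mE μ) v y' * GE (mE μ) 1 y) := by
    intro e v y y'
    have hG : ∀ x y, GE (mE μ) x y = ENNReal.ofReal (green μ x y) := fun x y => by
      rw [green_eq H.hμ, ENNReal.ofReal_toReal (H.hfin x y)]
    have hp := fun x y => (H.green_pos x y)
    simp only [hG]
    rw [← ENNReal.ofReal_mul (hp _ _).le, ← ENNReal.ofReal_mul (hp _ _).le,
      ← ENNReal.ofReal_mul (Real.exp_pos _).le, ENNReal.ofReal_le_ofReal_iff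
      (mul_pos (Real.exp_pos _) (mul_pos (hp _ _) (hp _ _))).le]
    unfold martinK
    rw [← mul_div_assoc, div_le_div_iff₀ (hp _ _) (hp _ _), mul_assoc]
  refine ⟨M, fun x y y' h1 h2 h3 => ?_⟩
  have := (conv _ _ _ _).2 (hR1 (max R1 R2) (le_max_left _ _) (ε / 2) x y y' h1 h2
    fun v hv => (conv _ _ _ _).1 (hM y y' h3 v hv))
  refine this.trans ?_
  have h4 := half_mono (le_max_right R1 R2)
  have := (H.mk_pos x y').le
  gcongr
  linarith

end


section
variable {S : Set Γ} {δ : ℝ} {μ : Γ → ℝ} {B : Boundary Γ S} {Kb : Γ → B.pt → ℝ}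

theorem fin_of_RN (hS : IsGenSet S) (hμ : IsRWMeasure S μ)
    (hKb : ∀ (x : Γ) (ξ : B.pt) (u : ℕ → Γ), ConvInf S u → B.cls u = ξ →
      Tendsto (fun n => martinK μ x (u n)) atTop (𝓝 (Kb x ξ)))
    [MeasurableSpace B.pt] (ν : Measure B.pt) (hν : IsProbabilityMeasure ν)
    (hRN : ∀ (g : Γ) (A : Set B.pt), MeasurableSet A →
      ν (B.smul g ⁻¹' A) = ∫⁻ ω in A, ENNReal.ofReal (Kb g ω) ∂ν) (x y : Γ) :
    GE (mE μ) x y ≠ ⊤ := by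
  by_cases h : ∃ y, GE (mE μ) 1 y ≠ ⊤
  · obtain ⟨y0, h0⟩ := h
    exact GE_fin hS (walk_mE hμ) h0 x y
  · exfalso
    push Not at h
    have h1 : ∀ x y, martinK μ x y = 0 := fun x y => by
      rw [martinK, green_eq hμ 1, h, ENNReal.toReal_top, div_zero]
    have h2 : ∀ ξ, Kb 1 ξ = 0 := by
      intro ξ
      obtain ⟨u, hu, hξ⟩ := B.cls_surj ξ
      have := hKb 1 ξ u hu hξ
      simp_rw [h1] at this
      exact tendsto_nhds_unique this tendsto_const_nhds
    have h3 := hRN 1 Set.univ MeasurableSet.univ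
    simp [h2] at h3

theorem Ctx.sum_le_one (H : Ctx S δ μ B Kb) (n : ℕ) (ω : B.pt) :
    ∑' g, PE (mE μ) n 1 g * ENNReal.ofReal (Kb g ω) ≤ 1 := by
  obtain ⟨u, hu, rfl⟩ := B.cls_surj ω
  rw [ENNReal.tsum_eq_iSup_sum]
  refine iSup_le fun F => ?_
  have ht : Tendsto (fun k => ∑ g ∈ F, PE (mE μ) n 1 g * ENNReal.ofReal (martinK μ g (u k))) atTop
      (𝓝 (∑ g ∈ F, PE (mE μ) n 1 g * ENNReal.ofReal (Kb g (B.cls u)))) := by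
    refine tendsto_finsetSum _ fun g _ => ?_
    refine ENNReal.Tendsto.const_mul ?_ (Or.inr (PE_ne_top (walk_mE H.hμ) _ _ _))
    exact (ENNReal.continuous_ofReal.tendsto _).comp (H.hKb g _ u hu rfl)
  refine le_of_tendsto' ht fun k => ?_
  have e : ∀ g, ENNReal.ofReal (martinK μ g (u k)) = GE (mE μ) g (u k) / GE (mE μ) 1 (u k) := by
    intro g
    rw [martinK_eq H.hμ, ENNReal.ofReal_toReal]
    exact ENNReal.div_ne_top (H.hfin _ _) (GE_pos (walk_mE H.hμ) _ _)
  simp_rw [e]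
  refine (ENNReal.sum_le_tsum F).trans ?_
  simp_rw [← mul_div_assoc, div_eq_mul_inv, ENNReal.tsum_mul_right]
  rw [← div_eq_mul_inv]
  exact ENNReal.div_le_of_le_mul (by rw [one_mul]; exact PE_GE_le _ _ _ _)

noncomputable def EE (μ : Γ → ℝ) (Kb : Γ → B.pt → ℝ) (n : ℕ) (ω : B.pt) : ℝ≥0∞ :=
  ∑' g, PE (mE μ) n 1 g * ENNReal.ofReal (√(Kb g ω))

theorem Ctx.EE_var (H : Ctx S δ μ B Kb) (n : ℕ) (ω : B.pt) :
    2 * EE μ Kb n ω + ∑' g, PE (mE μ) n 1 g * ENNReal.ofReal ((√(Kb g ω) - 1) ^ 2) ≤ 2 := by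
  have h1 := H.sum_le_one n ω
  have h2 := PE_sum (walk_mE H.hμ) n 1
  have : 2 * EE μ Kb n ω + ∑' g, PE (mE μ) n 1 g * ENNReal.ofReal ((√(Kb g ω) - 1) ^ 2) =
      ∑' g, PE (mE μ) n 1 g * ENNReal.ofReal (Kb g ω) + ∑' g, PE (mE μ) n 1 g := by
    unfold EE
    rw [← ENNReal.tsum_mul_left, ← ENNReal.tsum_add, ← ENNReal.tsum_add]
    refine tsum_congr fun g => ?_
    have hk := H.Kb_pos g ω
    have h0 := Real.sqrt_nonneg (Kb g ω)
    have h4 : (2 : ℝ≥0∞) = ENNReal.ofReal 2 := by simp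
    rw [h4, mul_left_comm, ← mul_add, ← ENNReal.ofReal_mul (by norm_num),
      ← ENNReal.ofReal_add (by positivity) (by positivity)]
    have h5 : 2 * √(Kb g ω) + (√(Kb g ω) - 1) ^ 2 = Kb g ω + 1 := by
      nlinarith [Real.sq_sqrt hk.le]
    rw [h5, ENNReal.ofReal_add hk.le zero_le_one, ENNReal.ofReal_one, mul_add, mul_one]
  rw [this, h2]
  calc _ ≤ (1 : ℝ≥0∞) + 1 := by gcongr
    _ = 2 := one_add_one_eq_two

theorem Ctx.EE_le_one (H : Ctx S δ μ B Kb) (n : ℕ) (ω : B.pt) : EE μ Kb n ω ≤ 1 := by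
  have h : 2 * EE μ Kb n ω ≤ 2 * 1 := by rw [mul_one]; exact le_self_add.trans (H.EE_var n ω)
  exact (ENNReal.mul_le_mul_iff_right two_ne_zero ENNReal.ofNat_ne_top).1 h

theorem Ctx.EE_add (H : Ctx S δ μ B Kb) (a b : ℕ) (ω : B.pt) :
    EE μ Kb (a + b) ω =
      ∑' z, PE (mE μ) a 1 z * ENNReal.ofReal (√(Kb z ω)) * EE μ Kb b (B.smul z⁻¹ ω) := by
  unfold EE
  simp_rw [PE_add, ← ENNReal.tsum_mul_right]
  rw [ENNReal.tsum_comm]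
  refine tsum_congr fun z => ?_
  rw [← (Equiv.mulLeft z).tsum_eq, ← ENNReal.tsum_mul_left]
  refine tsum_congr fun g => ?_
  have := PE_mul (mE μ) b z 1 g
  rw [mul_one] at this
  rw [Equiv.coe_mulLeft, this, H.Kb_mul, Real.sqrt_mul (H.Kb_pos _ _).le,
    ENNReal.ofReal_mul (Real.sqrt_nonneg _)]
  ring

theorem Ctx.EE_add_le (H : Ctx S δ μ B Kb) (a b : ℕ) (ρ : ℝ≥0∞) (hρ : ∀ ω, EE μ Kb b ω ≤ ρ)
    (ω : B.pt) : EE μ Kb (a + b) ω ≤ EE μ Kb a ω * ρ := by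
  rw [H.EE_add, EE, ← ENNReal.tsum_mul_right]
  exact ENNReal.tsum_le_tsum fun z => by gcongr; exact hρ _

theorem Ctx.EE_anti (H : Ctx S δ μ B Kb) {a b : ℕ} (h : a ≤ b) (ω : B.pt) :
    EE μ Kb b ω ≤ EE μ Kb a ω := by
  obtain ⟨c, rfl⟩ := Nat.exists_eq_add_of_le h
  simpa using H.EE_add_le a c 1 (H.EE_le_one c) ω

theorem Ctx.trivial_of_point (H : Ctx S δ μ B Kb) (p : B.pt) (hp : ∀ x, Kb x p = 1) :
    ∀ x ξ, Kb x ξ = 1 := by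
  intro x ξ
  obtain ⟨u, hu, rfl⟩ := B.cls_surj p
  obtain ⟨v, hv, rfl⟩ := B.cls_surj ξ
  obtain ⟨C, hC0, hC⟩ := exists_move H.hS H.hδ H.hne
  have h0 := H.hδ.1
  obtain ⟨i0, hi0⟩ := convInf_iff.1 hu (2 * C + δ + 1)
  choose s hs1 hs2 using fun n => hC (u i0) (v n)⁻¹
  have hs3 : ∀ n, ∀ i ≥ i0, g1 S (s n * u i) (v n)⁻¹ ≤ C + δ := by
    intro n i hi
    have a1 := g1_mul H.hS (s n) (u i0) (u i)
    have a2 := hi0 i0 le_rfl i hi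
    have := hyp_small H.hδ (s n * u i) (x := s n * u i0) (y := (v n)⁻¹) (hs2 n) (by
      linarith [hs1 n])
    rwa [g1_comm H.hS]
  have hlim := H.seq hv (u := fun n i => v n * s n * u i) (fun n => hu.mul H.hS _) (by
    intro N
    obtain ⟨n0, hn0⟩ := convInf_iff.1 hv (N + δ + C + δ)
    filter_upwards [eventually_ge_atTop n0] with n hn
    filter_upwards [eventually_ge_atTop i0] with i hi
    filter_upwards [eventually_ge_atTop n0] with j hj
    have a1 := g1_mul_left H.hS (v n) (s n * u i)
    have a2 := hs3 n i hi
    have a3 := hn0 n hn n hn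
    rw [g1_self H.hS] at a3
    have a4 := hn0 n hn j hj
    have := hyp' H.hS H.hδ (a := N + δ) (x := v n * (s n * u i)) (y := v j) (v n) (by linarith)
      (by linarith)
    rw [mul_assoc]
    linarith) x
  have hone : ∀ n, Kb x (B.cls fun i => v n * s n * u i) = 1 := by
    intro n
    rw [← B.smul_cls _ _ hu]
    have := H.Kb_mul (v n * s n)⁻¹ x (B.cls u)
    rw [hp, hp, inv_inv, one_mul] at this
    exact this.symm
  simp_rw [hone] at hlim
  exact tendsto_nhds_unique hlim tendsto_const_nhds

theorem Ctx.dichotomy (H : Ctx S δ μ B Kb)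
    (hbig : ∀ g : Γ, ∃ ω, 1 / 4 ≤ Kb g ω) :
    (∀ x ξ, Kb x ξ = 1) ∨ Decay (mE μ) := by
  by_cases hA : ∃ j : ℕ, ∃ ρ : ℝ, 0 < ρ ∧ ρ < 1 ∧ ∀ ω, EE μ Kb (j+1) ω ≤ ENNReal.ofReal ρ
  · right
    obtain ⟨j, ρ, h0, h1, hρ⟩ := hA
    have hk : ∀ k : ℕ, ∀ ω, EE μ Kb (k * (j + 1)) ω ≤ ENNReal.ofReal (ρ ^ k) := by
      intro k
      induction k with
      | zero => intro ω; simpa using H.EE_le_one _ ω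
      | succ k ih =>
        intro ω
        rw [add_mul, one_mul, pow_succ, ENNReal.ofReal_mul (by positivity)]
        refine (H.EE_add_le _ _ _ hρ ω).trans ?_
        gcongr
        exact ih ω
    set η : ℝ := ρ ^ (((j + 1 : ℕ) : ℝ)⁻¹) with hη
    have hη0 : 0 < η := Real.rpow_pos_of_pos h0 _
    have hηj : η ^ (j + 1) = ρ := Real.rpow_inv_natCast_pow h0.le (by omega)
    have hη1 : η < 1 := Real.rpow_lt_one h0.le h1 (by positivity)
    refine ⟨2 / ρ, η, by positivity, hη0, hη1, fun n x y => ?_⟩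
    have e0 : PE (mE μ) n x y = PE (mE μ) n 1 (x⁻¹ * y) := by
      have := PE_mul (mE μ) n x 1 (x⁻¹ * y)
      simpa using this
    rw [e0]
    generalize x⁻¹ * y = g
    obtain ⟨ω, hω⟩ := hbig g
    have e1 : EE μ Kb n ω ≤ ENNReal.ofReal (ρ ^ (n / (j + 1))) :=
      (H.EE_anti (Nat.div_mul_le_self n (j+1)) ω).trans (hk _ ω)
    have e2 : PE (mE μ) n 1 g * ENNReal.ofReal (√(Kb g ω)) ≤ EE μ Kb n ω :=
      ENNReal.le_tsum (f := fun g => PE (mE μ) n 1 g * ENNReal.ofReal (√(Kb g ω))) g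
    have e3 : (1 / 2 : ℝ) ≤ √(Kb g ω) := Real.le_sqrt_of_sq_le (by norm_num; linarith)
    have e4 : PE (mE μ) n 1 g * ENNReal.ofReal (1 / 2) ≤ ENNReal.ofReal (ρ ^ (n / (j + 1))) :=
      (mul_le_mul' le_rfl (ENNReal.ofReal_le_ofReal e3)).trans (e2.trans e1)
    have e5 : PE (mE μ) n 1 g = PE (mE μ) n 1 g * ENNReal.ofReal (1 / 2) * ENNReal.ofReal 2 := by
      rw [mul_assoc, ← ENNReal.ofReal_mul (by norm_num)]; norm_num
    rw [e5]
    refine (mul_le_mul' e4 le_rfl).trans ?_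
    rw [← ENNReal.ofReal_mul (by positivity)]
    refine ENNReal.ofReal_le_ofReal ?_
    have e6 : ρ ^ (n / (j + 1)) * ρ ≤ η ^ n := by
      rw [← pow_succ, ← hηj, ← pow_mul]
      exact pow_le_pow_of_le_one hη0.le hη1.le (Nat.lt_mul_div_succ n (by omega)).le
    rw [div_mul_eq_mul_div, le_div_iff₀ h0]
    linarith
  · left
    push Not at hA
    have hω : ∀ n : ℕ, ∃ ω, ENNReal.ofReal (1 - 1 / ((n:ℝ) + 2)) < EE μ Kb (n + 1) ω := by
      intro n
      refine hA n _ ?_ ?_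
      · rw [sub_pos, div_lt_one (by positivity)]
        have : (0:ℝ) ≤ n := Nat.cast_nonneg n
        linarith
      · have : 0 < 1 / ((n:ℝ) + 2) := by positivity
        linarith
    choose ω hω using hω
    obtain ⟨φ, hφ, p, hp⟩ := H.comp ω
    refine H.trivial_of_point p fun g => ?_
    obtain ⟨j, hj⟩ := PE_pos (walk_mE H.hμ) 1 g
    set P := (PE (mE μ) j 1 g).toReal with hP
    have hP0 : 0 < P := ENNReal.toReal_pos hj (PE_ne_top (walk_mE H.hμ) _ _ _)
    have hbd : ∀ n : ℕ, j ≤ n → P * (√(Kb g (ω n)) - 1) ^ 2 ≤ 2 * (1 / ((n:ℝ) + 2)) := by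
      intro n hn
      have a1 := H.EE_var j (ω n)
      have a2 : ENNReal.ofReal (1 - 1 / ((n:ℝ) + 2)) ≤ EE μ Kb j (ω n) :=
        (hω n).le.trans (H.EE_anti (by omega) _)
      have a3 : PE (mE μ) j 1 g * ENNReal.ofReal ((√(Kb g (ω n)) - 1) ^ 2) ≤ _ :=
        ENNReal.le_tsum (f := fun g => PE (mE μ) j 1 g * ENNReal.ofReal ((√(Kb g (ω n)) - 1) ^ 2)) g
      have a4 := (add_le_add (mul_le_mul' (le_refl (2:ℝ≥0∞)) a2) a3).trans a1
      have h4 : (2 : ℝ≥0∞) = ENNReal.ofReal 2 := by simp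
      have h5 : 0 ≤ 1 - 1 / ((n:ℝ) + 2) := by
        rw [sub_nonneg, div_le_one (by positivity)]
        have : (0:ℝ) ≤ n := Nat.cast_nonneg n
        linarith
      rw [h4, ← ENNReal.ofReal_toReal (PE_ne_top (walk_mE H.hμ) j 1 g), ← hP,
        ← ENNReal.ofReal_mul (by norm_num), ← ENNReal.ofReal_mul hP0.le,
        ← ENNReal.ofReal_add (by positivity) (by positivity),
        ENNReal.ofReal_le_ofReal_iff (by norm_num)] at a4
      linarith
    have hcont : Continuous fun t : ℝ => P * (√t - 1) ^ 2 := by fun_prop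
    have hl1 := (hcont.tendsto _).comp (hp g)
    have hl2 : Tendsto (fun n : ℕ => 2 * (1 / (((φ n : ℕ):ℝ) + 2))) atTop (𝓝 0) := by
      have : Tendsto (fun n : ℕ => 2 * (1 / ((n:ℝ) + 2))) atTop (𝓝 0) := by
        have h := (tendsto_one_div_add_atTop_nhds_zero_nat (𝕜 := ℝ)).comp (tendsto_add_atTop_nat 1)
        have h2 := h.const_mul 2
        simp only [Function.comp_def, mul_zero] at h2
        refine h2.congr fun n => ?_
        push_cast; ring
      exact this.comp hφ.tendsto_atTop
    have hle : P * (√(Kb g p) - 1) ^ 2 ≤ 0 := by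
      refine le_of_tendsto_of_tendsto hl1 hl2 ?_
      filter_upwards [eventually_ge_atTop j] with n hn
      exact hbd (φ n) (hn.trans (hφ.id_le n))
    have h1 : (√(Kb g p) - 1) ^ 2 = 0 := by
      have := sq_nonneg (√(Kb g p) - 1)
      nlinarith
    have h2 : √(Kb g p) = 1 := by
      have := pow_eq_zero_iff (two_ne_zero) |>.1 h1
      linarith
    rwa [Real.sqrt_eq_one] at h2

end


section
variable {S : Set Γ} {δ : ℝ} {μ : Γ → ℝ} {B : Boundary Γ S} {Kb : Γ → B.pt → ℝ}

/-- Closing lemma, geometric part. -/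
theorem closeA (hS : IsGenSet S) (hδ : IsHyperbolic S δ) {C M : ℝ} (hC0 : 0 ≤ C)
    (hC : ∀ y z : Γ, ∃ s : Γ, (wl S s : ℝ) ≤ C ∧ g1 S (s * y) z ≤ C)
    (hM : 4 * C + δ < M) (g : Γ) {u : ℕ → Γ} (hu : ConvInf S u)
    (hug : ∀ᶠ n in atTop, M ≤ g1 S (u n) (g⁻¹ * u n)) (R : ℝ) :
    ∃ p : Γ, g1 S p p⁻¹ ≤ 2 * C ∧ g1 S (g * p) (g * p)⁻¹ ≤ 2 * C + 2 * δ ∧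
      g1 S (g * p) p⁻¹ ≤ 2 * C + δ ∧ M - 2 * C ≤ g1 S p (g * p) ∧ R ≤ wl S p ∧
      R ≤ wl S (g * p) ∧ ∀ᶠ j in atTop, R ≤ g1 S p (g⁻¹ * u j) := by
  have h0 := hδ.1
  have hy := hu.mul hS g⁻¹
  set R' := max R 0 + wl S g + 4 * C + 4 * δ + 1 with hR'
  have hR1 := le_max_left R 0
  have hR2 := le_max_right R 0
  have hg0 : (0:ℝ) ≤ wl S g := Nat.cast_nonneg _
  obtain ⟨n0, hn0⟩ := convInf_iff.1 hy R'
  obtain ⟨n, hn, hn1⟩ := (hug.and (eventually_ge_atTop n0)).exists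
  have hlen := hn0 n hn1 n hn1
  rw [g1_self hS] at hlen
  set y := g⁻¹ * u n with hydef
  obtain ⟨s, hs1, hs2⟩ := hC y⁻¹ y
  have d1 : ds S (y * s⁻¹) y ≤ C := by
    rw [ds]; simpa using hs1
  have d1' : ds S y (y * s⁻¹) ≤ C := by rw [ds_comm hS]; exact d1
  have hgy : g * y = u n := by simp [hydef]
  have d2' : ds S (u n) (g * (y * s⁻¹)) ≤ C := by
    rw [← hgy, ds_mul]; exact d1'
  have pinv : (y * s⁻¹)⁻¹ = s * y⁻¹ := by simp
  have e1 : g1 S (y * s⁻¹) (y * s⁻¹)⁻¹ ≤ 2 * C := by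
    have := g1_lip hS (y * s⁻¹) y (s * y⁻¹)
    rw [pinv]
    rw [g1_comm hS y] at this
    linarith
  have hwp : R' - C ≤ wl S (y * s⁻¹) := by
    have a := g1_lip hS y (y * s⁻¹) y
    have b := g1_le_left hS (y * s⁻¹) y
    rw [g1_self hS] at a
    linarith
  have e2 : M - 2 * C ≤ g1 S (y * s⁻¹) (g * (y * s⁻¹)) := by
    have a := g1_lip hS y (y * s⁻¹) (u n)
    have b := g1_lip hS (u n) (g * (y * s⁻¹)) (y * s⁻¹)
    rw [g1_comm hS y] at a
    rw [g1_comm hS (u n) (y * s⁻¹), g1_comm hS (g * (y * s⁻¹))] at b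
    linarith
  generalize hp : y * s⁻¹ = p at *
  have e3 : g1 S (g * p) p⁻¹ ≤ 2 * C + δ := by
    rw [g1_comm hS]
    exact hyp_small hδ _ e1 (by linarith)
  have e4 : wl S p - wl S g ≤ g1 S p⁻¹ (g * p)⁻¹ := by
    rw [g1_eq hS, wl_inv hS, wl_inv hS]
    have a1 : ds S p⁻¹ (g * p)⁻¹ = wl S g := by
      rw [ds]
      have : p⁻¹⁻¹ * (g * p)⁻¹ = g⁻¹ := by group
      rw [this, wl_inv hS]
    have a2 : (wl S p : ℝ) ≤ wl S g + wl S (g * p) := by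
      have := wl_mul_le hS g⁻¹ (g * p)
      rw [inv_mul_cancel_left, wl_inv hS] at this
      exact_mod_cast this
    rw [a1]; linarith
  have e5 : g1 S (g * p) (g * p)⁻¹ ≤ 2 * C + 2 * δ := by
    rw [g1_comm hS] at e3
    have := hyp_small hδ (g * p)⁻¹ e3 (by linarith)
    linarith
  refine ⟨p, e1, e5, e3, e2, by linarith, ?_, ?_⟩
  · have a2 : (wl S p : ℝ) ≤ wl S g + wl S (g * p) := by
      have := wl_mul_le hS g⁻¹ (g * p)
      rw [inv_mul_cancel_left, wl_inv hS] at this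
      exact_mod_cast this
    linarith
  · filter_upwards [eventually_ge_atTop n0] with j hj
    have a := hn0 n hn1 j hj
    have b := g1_lip hS y p (g⁻¹ * u j)
    simp only [← hydef] at a
    linarith

theorem Ctx.closing (H : Ctx S δ μ B Kb) (hd : Decay (mE μ)) {lam : ℝ} (hlam : 0 < lam)
    (hsub : ∀ g : Γ, ∃ n : ℤ, rfun B Kb g = lam ^ n) {ε : ℝ} (hε : 0 < ε) :
    ∃ M : ℝ, ∀ (g : Γ) (u : ℕ → Γ), ConvInf S u →
      (∀ᶠ n in atTop, M ≤ g1 S (u n) (g⁻¹ * u n)) →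
      ∃ n : ℤ, Kb g (B.cls u) ≤ Real.exp ε * lam ^ n ∧ lam ^ n ≤ Real.exp ε * Kb g (B.cls u) := by
  have hS := H.hS
  have hδ := H.hδ
  have h0 := hδ.1
  obtain ⟨C, hC0, hC⟩ := exists_move hS hδ H.hne
  obtain ⟨M', hM'⟩ := H.equi hd (2 * C + 3 * δ) (half_pos hε)
  refine ⟨max (M' + 2 * C + 2 * δ) (4 * C + δ + 1), fun g u hu hug => ?_⟩
  set M := max (M' + 2 * C + 2 * δ) (4 * C + δ + 1)
  have hMa : M' + 2 * C + 2 * δ ≤ M := le_max_left _ _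
  have hMb : 4 * C + δ + 1 ≤ M := le_max_right _ _
  have hA := closeA hS hδ hC0 hC (by linarith) g hu hug
  have hB : ∀ n : ℕ, ∃ q p : Γ, ConvInf S (fun k => q ^ k) ∧
      (∀ᶠ i in atTop, ∀ᶠ j in atTop, (n : ℝ) ≤ g1 S (p * q ^ i) (g⁻¹ * u j)) ∧
      ∃ m : ℤ, Kb g⁻¹ (B.cls fun k => p * q ^ k) ≤ Real.exp (ε/2) * lam ^ m ∧
        lam ^ m ≤ Real.exp (ε/2) * Kb g⁻¹ (B.cls fun k => p * q ^ k) := by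
    intro n
    set R := (n:ℝ) + M + 8 * C + 20 * δ + 1 with hR
    have hn0 : (0:ℝ) ≤ n := Nat.cast_nonneg n
    obtain ⟨p, e1, e2, e3, e4, e5, e6, e7⟩ := hA R
    obtain ⟨p1, p2, p3, p4⟩ := hypElem hS hδ (q := p) (C := 2 * C + 2 * δ) (by linarith)
      (by linarith)
    obtain ⟨q1, q2, q3, q4⟩ := hypElem hS hδ (q := g * p) (C := 2 * C + 2 * δ) (by linarith)
      (by linarith)
    set q := g * p with hq
    have f1 : ∀ k : ℕ, g1 S p⁻¹ (q ^ (k+1)) ≤ 2 * C + 2 * δ := by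
      intro k
      have a := q2 k
      rw [g1_comm hS] at a
      have := hyp_small hδ (q ^ (k+1)) e3 (by linarith)
      linarith
    have f2 : ∀ k : ℕ, M' ≤ g1 S (q ^ (k+1)) (p ^ (k+1)) := by
      intro k
      have a := q2 k
      have b := p2 k
      rw [g1_comm hS] at e4 b
      have c := hyp' hS hδ (a := M - 2 * C) q (x := q ^ (k+1)) (y := p) (by linarith) e4
      have := hyp' hS hδ (a := M - 2 * C - δ) p c (y := p ^ (k+1)) (by linarith)
      linarith
    have f3 : ∀ k : ℕ, g1 S p⁻¹ (p ^ (k+1)) ≤ 2 * C + 3 * δ := by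
      intro k
      have := p1 k
      rw [g1_comm hS] at this
      linarith
    refine ⟨q, p, q3, ?_, ?_⟩
    · filter_upwards [eventually_ge_atTop 1] with i hi
      filter_upwards [e7] with j hj
      obtain ⟨k, rfl⟩ := Nat.exists_eq_add_of_le' hi
      have a := g1_mul_left hS p (q ^ (k+1))
      have b := f1 k
      rw [g1_comm hS] at b
      have := hyp' hS hδ (a := n + δ) p (x := p * q ^ (k+1)) (y := g⁻¹ * u j) (by linarith)
        (by linarith)
      linarith
    · obtain ⟨a, ha⟩ := hsub q
      obtain ⟨b, hb⟩ := hsub p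
      rw [rfun, if_neg q4, plusPt] at ha
      rw [rfun, if_neg p4, plusPt] at hb
      have t1 := (H.hKb q⁻¹ _ _ q3 rfl).comp (tendsto_add_atTop_nat 1)
      have t2 := (H.hKb p⁻¹ _ _ p3 rfl).comp (tendsto_add_atTop_nat 1)
      have t3 := (H.hKb g⁻¹ _ _ (q3.mul hS p) rfl).comp (tendsto_add_atTop_nat 1)
      rw [ha] at t1
      rw [hb] at t2
      set L := Kb g⁻¹ (B.cls fun k => p * q ^ k) with hL
      have hmul : ∀ k : ℕ, martinK μ q⁻¹ (q ^ (k+1)) =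
          martinK μ p⁻¹ (q ^ (k+1)) * martinK μ g⁻¹ (p * q ^ (k+1)) := by
        intro k
        have := H.mk_mul p⁻¹ g⁻¹ (q ^ (k+1))
        rw [inv_inv, ← mul_inv_rev, ← hq] at this
        exact this
      have ineq1 : lam ^ a ≤ Real.exp (ε/2) * lam ^ b * L := by
        refine le_of_tendsto_of_tendsto' t1 ((t2.const_mul (Real.exp (ε/2))).mul t3) fun k => ?_
        simp only [Function.comp]
        rw [hmul]
        have := H.mk_pos g⁻¹ (p * q ^ (k+1))
        have := hM' p⁻¹ (q ^ (k+1)) (p ^ (k+1)) (by linarith [f1 k]) (f3 k) (f2 k)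
        gcongr
      have ineq2 : lam ^ b * L ≤ Real.exp (ε/2) * lam ^ a := by
        refine le_of_tendsto_of_tendsto' (t2.mul t3) (t1.const_mul (Real.exp (ε/2))) fun k => ?_
        simp only [Function.comp]
        rw [hmul, ← mul_assoc]
        have := H.mk_pos g⁻¹ (p * q ^ (k+1))
        have := hM' p⁻¹ (p ^ (k+1)) (q ^ (k+1)) (f3 k) (by linarith [f1 k])
          (by rw [g1_comm hS]; exact f2 k)
        gcongr
      have hlb : 0 < lam ^ b := zpow_pos hlam b
      refine ⟨a - b, ?_, ?_⟩
      · rw [zpow_sub₀ hlam.ne', ← mul_div_assoc, le_div_iff₀ hlb]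
        linarith
      · rw [zpow_sub₀ hlam.ne', div_le_iff₀ hlb]
        linarith
  choose q p hq1 hq2 m hm1 hm2 using hB
  have hy := hu.mul hS g⁻¹
  have hlim := H.seq hy (u := fun n k => p n * q n ^ k) (fun n => (hq1 n).mul hS _) (by
    intro N
    obtain ⟨n0, hn0⟩ := exists_nat_ge N
    filter_upwards [eventually_ge_atTop n0] with n hn
    refine (hq2 n).mono fun i hi => hi.mono fun j hj => ?_
    have : (n0:ℝ) ≤ n := by exact_mod_cast hn
    linarith) g⁻¹
  have hinv := H.Kb_inv g (B.cls u)
  rw [B.smul_cls _ _ hu] at hinv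
  set L := Kb g⁻¹ (B.cls fun n => g⁻¹ * u n) with hL
  have hL0 : 0 < L := H.Kb_pos _ _
  have hK0 := H.Kb_pos g (B.cls u)
  have hexp : 1 < Real.exp (ε/2) := Real.one_lt_exp_iff.2 (by linarith)
  have l1 := hlim.eventually_lt (tendsto_const_nhds (x := Real.exp (ε/2) * L)) (by nlinarith)
  have l2 := (tendsto_const_nhds (x := L)).eventually_lt (hlim.const_mul (Real.exp (ε/2)))
    (by nlinarith)
  obtain ⟨n, hn1, hn2⟩ := (l1.and l2).exists
  have a1 := hm1 n
  have a2 := hm2 n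
  have hee : Real.exp ε = Real.exp (ε/2) * Real.exp (ε/2) := by rw [← Real.exp_add]; ring_nf
  have b1 : L ≤ Real.exp ε * lam ^ (m n) := by
    rw [hee]; nlinarith [hn2.le]
  have b2 : lam ^ (m n) ≤ Real.exp ε * L := by
    rw [hee]; nlinarith [hn1.le]
  have hl : 0 < lam ^ (m n) := zpow_pos hlam _
  have hKL : Kb g (B.cls u) = L⁻¹ := eq_inv_of_mul_eq_one_left hinv
  refine ⟨- m n, ?_, ?_⟩
  · rw [hKL, zpow_neg, ← div_eq_mul_inv, le_div_iff₀ hl, inv_mul_le_iff₀ hL0]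
    linarith
  · rw [hKL, zpow_neg, ← div_eq_mul_inv, le_div_iff₀ hL0, inv_mul_le_iff₀ hl]
    linarith

end


section
variable {S : Set Γ} {δ : ℝ} {μ : Γ → ℝ} {B : Boundary Γ S} {Kb : Γ → B.pt → ℝ}

theorem pair_ev {P : ℕ → ℕ → Prop} :
    (∀ᶠ p : ℕ × ℕ in atTop, P p.1 p.2) ↔ ∃ n0 : ℕ, ∀ i ≥ n0, ∀ j ≥ n0, P i j := by
  rw [eventually_atTop]
  constructor
  · rintro ⟨⟨a, b⟩, h⟩
    exact ⟨max a b, fun i hi j hj => h (i, j)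
      ⟨(le_max_left _ _).trans hi, (le_max_right _ _).trans hj⟩⟩
  · rintro ⟨n0, h⟩
    exact ⟨(n0, n0), fun p hp => h p.1 hp.1 p.2 hp.2⟩

theorem lt_bgp {ξ η : B.pt} {r : ℝ≥0∞} (hr : r ≠ ⊤) (h : r < bgp B ξ η) :
    ∃ u v : ℕ → Γ, ConvInf S u ∧ B.cls u = ξ ∧ ConvInf S v ∧ B.cls v = η ∧
      ∃ n0 : ℕ, ∀ i ≥ n0, ∀ j ≥ n0, r.toReal ≤ g1 S (u i) (v j) := by
  unfold bgp at h
  obtain ⟨u, h⟩ := lt_iSup_iff.1 h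
  obtain ⟨v, h⟩ := lt_iSup_iff.1 h
  refine ⟨u.1, v.1, u.2.1, u.2.2, v.2.1, v.2.2, ?_⟩
  have := eventually_lt_of_lt_liminf h
  have h2 := (pair_ev (P := fun i j => r < ENNReal.ofReal (gp S 1 (u.1 i) (v.1 j)))).1 this
  obtain ⟨n0, h3⟩ := h2
  exact ⟨n0, fun i hi j hj => ((ENNReal.lt_ofReal_iff_toReal_lt hr).1 (h3 i hi j hj)).le⟩

theorem le_bgp {u v : ℕ → Γ} (hu : ConvInf S u) (hv : ConvInf S v) {a : ℝ}
    (h : ∃ n0 : ℕ, ∀ i ≥ n0, ∀ j ≥ n0, a ≤ g1 S (u i) (v j)) :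
    ENNReal.ofReal a ≤ bgp B (B.cls u) (B.cls v) := by
  unfold bgp
  refine le_iSup_of_le ⟨u, hu, rfl⟩ (le_iSup_of_le ⟨v, hv, rfl⟩ ?_)
  refine le_liminf_of_le (by isBoundedDefault) ?_
  refine (pair_ev (P := fun i j => ENNReal.ofReal a ≤ ENNReal.ofReal (gp S 1 (u i) (v j)))).2 ?_
  obtain ⟨n0, h⟩ := h
  exact ⟨n0, fun i hi j hj => ENNReal.ofReal_le_ofReal (h i hi j hj)⟩

theorem lt_bgp_of {u v : ℕ → Γ} (hu : ConvInf S u) (hv : ConvInf S v) {r : ℝ≥0∞} (hr : r ≠ ⊤)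
    (h : ∃ n0 : ℕ, ∀ i ≥ n0, ∀ j ≥ n0, r.toReal + 1 ≤ g1 S (u i) (v j)) :
    r < bgp B (B.cls u) (B.cls v) := by
  refine lt_of_lt_of_le ?_ (le_bgp hu hv h)
  rw [ENNReal.lt_ofReal_iff_toReal_lt hr]
  linarith

theorem g1_chg (hS : IsGenSet S) (hδ : IsHyperbolic S δ) {u v v' : ℕ → Γ} (h : EquivSeq S v v')
    {a : ℝ} (ha : ∃ n0 : ℕ, ∀ i ≥ n0, ∀ j ≥ n0, a ≤ g1 S (u i) (v j)) :
    ∃ n0 : ℕ, ∀ i ≥ n0, ∀ j ≥ n0, a - δ ≤ g1 S (u i) (v' j) := by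
  obtain ⟨n0, h1⟩ := ha
  obtain ⟨n1, h2⟩ := equivSeq_iff.1 h a
  refine ⟨max n0 n1, fun i hi j hj => ?_⟩
  exact hyp' hS hδ (v (max n0 n1)) (h1 i ((le_max_left _ _).trans hi) _ (le_max_left _ _))
    (h2 _ (le_max_right _ _) j ((le_max_right _ _).trans hj))

theorem cls_equiv (B : Boundary Γ S) {u v : ℕ → Γ} (hu : ConvInf S u) (hv : ConvInf S v)
    (h : B.cls u = B.cls v) : EquivSeq S u v := (B.cls_eq u v hu hv).1 h

theorem Ctx.Kb_cont (H : Ctx S δ μ B Kb) (x : Γ) : @Continuous _ _ (btop B) _ (Kb x) := by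
  let _ := btop B
  refine continuous_def.2 fun O hO => ?_
  intro p hp
  by_contra hcon
  push Not at hcon
  have hq := fun n : ℕ => Set.not_subset.1 (hcon n (ENNReal.natCast_ne_top n))
  choose q hq1 hq2 using hq
  choose u v hu1 hu2 hv1 hv2 huv using fun n : ℕ => lt_bgp (ENNReal.natCast_ne_top n) (hq1 n)
  obtain ⟨w, hw, hwp⟩ := B.cls_surj p
  have hlim := H.seq hw (u := u) hu1 (by
    intro N
    obtain ⟨n0, hn0⟩ := exists_nat_ge (N + δ)
    filter_upwards [eventually_ge_atTop n0] with n hn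
    obtain ⟨k, hk⟩ := g1_chg H.hS H.hδ (cls_equiv B (hv1 n) hw ((hv2 n).trans hwp.symm)) (huv n)
    filter_upwards [eventually_ge_atTop k] with i hi
    filter_upwards [eventually_ge_atTop k] with j hj
    have a := hk i hi j hj
    rw [ENNReal.toReal_natCast] at a
    have : (n0:ℝ) ≤ n := by exact_mod_cast hn
    linarith) x
  simp_rw [hu2, hwp] at hlim
  obtain ⟨n, hn⟩ := (hlim.eventually (hO.mem_nhds hp)).exists
  exact hq2 n hn

theorem Ctx.smul_cont (H : Ctx S δ μ B Kb) (g : Γ) :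
    @Continuous _ _ (btop B) (btop B) (B.smul g) := by
  let _ := btop B
  refine continuous_def.2 fun O hO => ?_
  intro p hp
  obtain ⟨r, hr, hsub⟩ := hO _ hp
  have hr' : r + 1 + (wl S g : ℝ≥0∞) ≠ ⊤ := by finiteness
  refine ⟨r + 1 + (wl S g : ℝ≥0∞), hr', fun q hq => hsub ?_⟩
  obtain ⟨u, v, hu, rfl, hv, rfl, n0, h⟩ := lt_bgp hr' hq
  show r < bgp B _ _
  rw [B.smul_cls _ _ hu, B.smul_cls _ _ hv]
  refine lt_bgp_of (hu.mul H.hS g) (hv.mul H.hS g) hr ⟨n0, fun i hi j hj => ?_⟩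
  have a := h i hi j hj
  rw [ENNReal.toReal_add (by finiteness) (by finiteness), ENNReal.toReal_add hr (by finiteness)] at a
  simp only [ENNReal.toReal_one, ENNReal.toReal_natCast] at a
  have := g1_mul H.hS g (u i) (v j)
  linarith

/-- Shadows. -/
def Sh (B : Boundary Γ S) (a : ℝ) (x : Γ) : Set B.pt :=
  {ω | ∃ u, ConvInf S u ∧ B.cls u = ω ∧ ∃ n0 : ℕ, ∀ n ≥ n0, a ≤ g1 S x (u n)}

theorem Sh_rep (hS : IsGenSet S) (hδ : IsHyperbolic S δ) {a : ℝ} {x : Γ} {u : ℕ → Γ}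
    (hu : ConvInf S u) (h : B.cls u ∈ Sh B a x) : ∃ n0 : ℕ, ∀ n ≥ n0, a - δ ≤ g1 S x (u n) := by
  obtain ⟨v, hv, hvu, n0, h⟩ := h
  obtain ⟨n1, h1⟩ := g1_chg hS hδ (u := fun _ => x) (cls_equiv B hv hu hvu) (a := a)
    ⟨n0, fun _ _ j hj => h j hj⟩
  exact ⟨n1, fun n hn => h1 n hn n hn⟩

theorem Sh_cover (hS : IsGenSet S) (hδ : IsHyperbolic S δ) (k : ℕ) (ω : B.pt) :
    ∃ x : Γ, wl S x = k ∧ ω ∈ Sh B (k - δ) x := by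
  obtain ⟨u, hu, rfl⟩ := B.cls_surj ω
  obtain ⟨n0, hn0⟩ := convInf_iff.1 hu k
  have hl := hn0 n0 le_rfl n0 le_rfl
  rw [g1_self hS] at hl
  have hl' : k ≤ wl S (u n0) := by exact_mod_cast hl
  obtain ⟨x, hx1, hx2⟩ := exists_start_seg hS (u n0) k hl'
  refine ⟨x, hx1, u, hu, rfl, n0, fun n hn => ?_⟩
  refine hyp' hS hδ (u n0) ?_ (hn0 n0 le_rfl n hn)
  rw [g1_eq hS, hx1, ds, hx2, Nat.cast_sub hl']
  linarith

/-- Open thickening of shadows. -/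
def Ob (B : Boundary Γ S) (A : Set B.pt) : Set B.pt :=
  {q | ∃ r : ℝ≥0∞, r ≠ ⊤ ∧ {q' | r < bgp B q' q} ⊆ A}

theorem Ob_subset {A : Set B.pt} : Ob B A ⊆ A := by
  rintro q ⟨r, hr, h⟩
  refine h ?_
  obtain ⟨u, hu, rfl⟩ := B.cls_surj q
  exact lt_bgp_of hu hu hr (convInf_iff.1 hu _)

theorem Ob_open (hS : IsGenSet S) (hδ : IsHyperbolic S δ) {A : Set B.pt} :
    @IsOpen _ (btop B) (Ob B A) := by
  rintro p ⟨r, hr, h⟩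
  have h0 := hδ.1
  have hr' : r + 1 + ENNReal.ofReal (2 * δ) ≠ ⊤ := by finiteness
  have hrr : (r + 1 + ENNReal.ofReal (2 * δ)).toReal = r.toReal + 1 + 2 * δ := by
    rw [ENNReal.toReal_add (by finiteness) (by finiteness), ENNReal.toReal_add hr (by finiteness),
      ENNReal.toReal_ofReal (by linarith), ENNReal.toReal_one]
  refine ⟨r + 1 + ENNReal.ofReal (2 * δ), hr', fun q hq => ?_⟩
  refine ⟨r + 1 + ENNReal.ofReal (2 * δ), hr', fun q' hq' => h ?_⟩
  obtain ⟨u, v, hu, rfl, hv, rfl, h1⟩ := lt_bgp hr' hq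
  obtain ⟨u', v', hu', rfl, hv', hvv, h2⟩ := lt_bgp hr' hq'
  obtain ⟨n1, h1⟩ := h1
  obtain ⟨n2, h2⟩ := g1_chg hS hδ (cls_equiv B hv' hu hvv) h2
  refine lt_bgp_of hu' hv hr ⟨max n1 n2, fun i hi j hj => ?_⟩
  rw [hrr] at h1 h2
  have b1 := h2 i ((le_max_right _ _).trans hi) (max n1 n2) (le_max_right _ _)
  have b2 := h1 (max n1 n2) (le_max_left _ _) j ((le_max_left _ _).trans hj)
  have a := hyp' hS hδ (a := r.toReal + 1 + δ) (x := u' i) (y := v j) (u (max n1 n2))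
    (by linarith) (by linarith)
  linarith

theorem Sh_Ob (hS : IsGenSet S) (hδ : IsHyperbolic S δ) (a : ℝ) (x : Γ) :
    Sh B a x ⊆ Ob B (Sh B (a - 2 * δ) x) := by
  intro ω hω
  refine ⟨ENNReal.ofReal a, ENNReal.ofReal_ne_top, fun q hq => ?_⟩
  obtain ⟨u, v, hu, rfl, hv, rfl, n0, h⟩ := lt_bgp ENNReal.ofReal_ne_top hq
  obtain ⟨n1, h1⟩ := Sh_rep hS hδ hv hω
  refine ⟨u, hu, rfl, n0, fun n hn => ?_⟩
  have h0 := hδ.1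
  have b := h n hn (max n0 n1) (le_max_left _ _)
  have c : a ≤ (ENNReal.ofReal a).toReal := by rw [ENNReal.toReal_ofReal']; exact le_max_left _ _
  rw [g1_comm hS] at b
  have := hyp' hS hδ (a := a - δ) (v (max n0 n1)) (h1 _ (le_max_right _ _)) (y := u n) (by linarith)
  linarith

theorem exists_piece (hS : IsGenSet S) (hδ : IsHyperbolic S δ) (M : ℝ)
    [mB : MeasurableSpace B.pt] (hmB : mB = @borel B.pt (btop B))
    (ν : Measure B.pt) (hν : IsProbabilityMeasure ν) :
    ∃ A : Set B.pt, MeasurableSet A ∧ 0 < ν A ∧ ∀ u v : ℕ → Γ, ConvInf S u → ConvInf S v →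
      B.cls u ∈ A → B.cls v ∈ A → ∀ᶠ n in atTop, M ≤ g1 S (u n) (v n) := by
  obtain ⟨k, hk⟩ := exists_nat_ge (M + 5 * δ)
  have hex : ∃ x ∈ {g : Γ | wl S g ≤ k}, ν (Ob B (Sh B (k - δ - 2 * δ) x)) ≠ 0 := by
    by_contra hcon
    push Not at hcon
    have h1 : ν (⋃ x ∈ {g : Γ | wl S g ≤ k}, Ob B (Sh B (k - δ - 2 * δ) x)) = 0 :=
      (measure_biUnion_null_iff (finite_ball hS k).countable).2 hcon
    have h2 : (⋃ x ∈ {g : Γ | wl S g ≤ k}, Ob B (Sh B (k - δ - 2 * δ) x)) = Set.univ := by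
      refine Set.eq_univ_of_forall fun ω => ?_
      obtain ⟨x, hx1, hx2⟩ := Sh_cover hS hδ k ω
      exact Set.mem_biUnion (x := x) hx1.le (Sh_Ob hS hδ _ _ hx2)
    rw [h2, measure_univ] at h1
    exact one_ne_zero h1
  obtain ⟨x, -, hx⟩ := hex
  refine ⟨_, ?_, pos_iff_ne_zero.2 hx, fun u v hu hv hua hva => ?_⟩
  · rw [hmB]
    exact MeasurableSpace.measurableSet_generateFrom (Ob_open hS hδ)
  · obtain ⟨n1, h1⟩ := Sh_rep hS hδ hu (Ob_subset hua)
    obtain ⟨n2, h2⟩ := Sh_rep hS hδ hv (Ob_subset hva)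
    filter_upwards [eventually_ge_atTop n1, eventually_ge_atTop n2] with n a1 a2
    have b := h1 n a1
    rw [g1_comm hS] at b
    have := hyp' hS hδ x b (h2 n a2)
    linarith

end


section
variable {S : Set Γ} {δ : ℝ} {μ : Γ → ℝ} {B : Boundary Γ S} {Kb : Γ → B.pt → ℝ}

theorem Ctx.Kb_meas (H : Ctx S δ μ B Kb)
    [mB : MeasurableSpace B.pt] (hmB : mB = @borel B.pt (btop B)) (g : Γ) : Measurable (Kb g) := by
  let _ := btop B
  have : BorelSpace B.pt := ⟨hmB⟩
  exact (H.Kb_cont g).measurable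

theorem Ctx.smul_meas (H : Ctx S δ μ B Kb)
    [mB : MeasurableSpace B.pt] (hmB : mB = @borel B.pt (btop B)) (g : Γ) :
    Measurable (B.smul g) := by
  let _ := btop B
  have : BorelSpace B.pt := ⟨hmB⟩
  exact (H.smul_cont g).measurable

theorem Ctx.one_mem (H : Ctx S δ μ B Kb) [MeasurableSpace B.pt] (ν : Measure B.pt) :
    (1 : ℝ) ∈ ratioSet B ν Kb := by
  refine ⟨zero_le_one, fun ε hε A hA hνA => ⟨1, ?_⟩⟩
  refine hνA.trans_le (measure_mono fun ω hω => ?_)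
  refine ⟨hω, ?_, ?_⟩
  · rw [inv_one, H.smul_one]; exact hω
  · rw [H.Kb_one, sub_self, abs_zero]; exact hε

theorem Ctx.meas_set (H : Ctx S δ μ B Kb)
    [mB : MeasurableSpace B.pt] (hmB : mB = @borel B.pt (btop B)) {A : Set B.pt}
    (hA : MeasurableSet A) (g : Γ) (x η : ℝ) :
    MeasurableSet {ω | ω ∈ A ∧ B.smul g⁻¹ ω ∈ A ∧ |Kb g ω - x| < η} := by
  have h1 := H.smul_meas hmB g⁻¹ hA
  have h2 : Measurable fun ω => |Kb g ω - x| :=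
    continuous_abs.measurable.comp ((H.Kb_meas hmB g).sub_const x)
  exact hA.inter (h1.inter (h2 measurableSet_Iio))

theorem Ctx.mul_mem (H : Ctx S δ μ B Kb)
    [mB : MeasurableSpace B.pt] (hmB : mB = @borel B.pt (btop B)) (ν : Measure B.pt) {x y : ℝ}
    (hx : x ∈ ratioSet B ν Kb) (hy : y ∈ ratioSet B ν Kb) : x * y ∈ ratioSet B ν Kb := by
  refine ⟨mul_nonneg hx.1 hy.1, fun ε hε A hA hνA => ?_⟩
  have hc : ContinuousAt (fun p : ℝ × ℝ => p.1 * p.2) (x, y) := by fun_prop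
  obtain ⟨η, hη, hc⟩ := Metric.continuousAt_iff.1 hc ε hε
  obtain ⟨g, hg⟩ := hx.2 η hη A hA hνA
  obtain ⟨h, hh⟩ := hy.2 η hη _ (H.meas_set hmB hA g x η) hg
  refine ⟨h * g, hh.trans_le (measure_mono ?_)⟩
  rintro ω ⟨⟨a1, a2, a3⟩, ⟨b1, b2, b3⟩, c⟩
  refine ⟨a1, ?_, ?_⟩
  · rw [mul_inv_rev, H.smul_mul]; exact b2
  · rw [H.Kb_mul, mul_comm (Kb h ω)]
    refine hc (x := (Kb g (B.smul h⁻¹ ω), Kb h ω)) ?_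
    rw [Prod.dist_eq, Real.dist_eq, Real.dist_eq]
    exact max_lt b3 c

theorem Ctx.inv_mem (H : Ctx S δ μ B Kb)
    [mB : MeasurableSpace B.pt] (hmB : mB = @borel B.pt (btop B)) (ν : Measure B.pt)
    (hRN : ∀ (g : Γ) (A : Set B.pt), MeasurableSet A →
      ν (B.smul g ⁻¹' A) = ∫⁻ ω in A, ENNReal.ofReal (Kb g ω) ∂ν) {x : ℝ} (h0 : x ≠ 0)
    (hx : x ∈ ratioSet B ν Kb) : x⁻¹ ∈ ratioSet B ν Kb := by
  refine ⟨inv_nonneg.2 hx.1, fun ε hε A hA hνA => ?_⟩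
  have hc : ContinuousAt (fun p : ℝ => p⁻¹) x := continuousAt_inv₀ h0
  obtain ⟨η, hη, hc⟩ := Metric.continuousAt_iff.1 hc ε hε
  obtain ⟨g, hg⟩ := hx.2 η hη A hA hνA
  have hE := H.meas_set hmB hA g x η
  have hpos := hRN g _ hE
  have hm : Measurable fun ω => ENNReal.ofReal (Kb g ω) := (H.Kb_meas hmB g).ennreal_ofReal
  have hp2 : 0 < ν (B.smul g ⁻¹' {ω | ω ∈ A ∧ B.smul g⁻¹ ω ∈ A ∧ |Kb g ω - x| < η}) := by
    rw [hpos, setLIntegral_pos_iff hm]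
    have : Function.support (fun ω => ENNReal.ofReal (Kb g ω)) = Set.univ := by
      refine Set.eq_univ_of_forall fun ω => ?_
      exact (ENNReal.ofReal_pos.2 (H.Kb_pos g ω)).ne'
    rw [this, Set.univ_inter]
    exact hg
  refine ⟨g⁻¹, hp2.trans_le (measure_mono ?_)⟩
  rintro ω ⟨a1, a2, a3⟩
  have e : B.smul g⁻¹ (B.smul g ω) = ω := by rw [← H.smul_mul, inv_mul_cancel, H.smul_one]
  rw [e] at a2
  refine ⟨a2, by rw [inv_inv]; exact a1, ?_⟩
  have hk := H.Kb_inv g (B.smul g ω)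
  rw [e] at hk
  rw [eq_inv_of_mul_eq_one_right hk]
  exact hc (by rw [Real.dist_eq]; exact a3)

theorem exists_big [MeasurableSpace B.pt] (ν : Measure B.pt) (hν : IsProbabilityMeasure ν)
    (hRN : ∀ (g : Γ) (A : Set B.pt), MeasurableSet A →
      ν (B.smul g ⁻¹' A) = ∫⁻ ω in A, ENNReal.ofReal (Kb g ω) ∂ν) (g : Γ) :
    ∃ ω, 1 / 4 ≤ Kb g ω := by
  by_contra hcon
  push Not at hcon
  have h1 := hRN g Set.univ MeasurableSet.univ
  rw [Set.preimage_univ, Measure.restrict_univ, measure_univ] at h1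
  have h2 : ∫⁻ ω, ENNReal.ofReal (Kb g ω) ∂ν ≤ ∫⁻ _, ENNReal.ofReal (1/4) ∂ν :=
    lintegral_mono fun ω => ENNReal.ofReal_le_ofReal (hcon ω).le
  rw [← h1, lintegral_const, measure_univ, mul_one, ENNReal.one_le_ofReal] at h2
  norm_num at h2

theorem lac_of_approx {lam x : ℝ} (h0 : 0 < lam) (h1 : lam < 1) (hx : 0 < x)
    (h : ∀ ε : ℝ, 0 < ε → ∃ n : ℤ, |Real.log x - n * Real.log lam| ≤ ε) :
    ∃ n : ℤ, x = lam ^ n := by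
  have hl : Real.log lam < 0 := Real.log_neg h0 h1
  set t := Real.log x / Real.log lam with ht
  have hxt : Real.log x = t * Real.log lam := by rw [ht, div_mul_cancel₀ _ hl.ne]
  refine ⟨round t, ?_⟩
  have hd : |t - round t| = 0 := by
    by_contra hne
    have hpos : 0 < |t - round t| := lt_of_le_of_ne (abs_nonneg _) (Ne.symm hne)
    have hla : 0 < |Real.log lam| := abs_pos.2 hl.ne
    obtain ⟨n, hn⟩ := h (|t - round t| * |Real.log lam| / 2) (by positivity)
    rw [hxt, ← sub_mul, abs_mul] at hn
    have := round_le t n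
    have := mul_le_mul_of_nonneg_right this hla.le
    nlinarith [mul_pos hpos hla]
  have ht2 : t = round t := by
    have := abs_eq_zero.1 hd
    linarith
  have : Real.log x = Real.log (lam ^ (round t)) := by
    rw [Real.log_zpow, hxt, ← ht2]
  exact Real.log_injOn_pos hx (zpow_pos h0 _) this

theorem Ctx.lac (H : Ctx S δ μ B Kb)
    [mB : MeasurableSpace B.pt] (hmB : mB = @borel B.pt (btop B)) (ν : Measure B.pt)
    (hν : IsProbabilityMeasure ν)
    (hRN : ∀ (g : Γ) (A : Set B.pt), MeasurableSet A →
      ν (B.smul g ⁻¹' A) = ∫⁻ ω in A, ENNReal.ofReal (Kb g ω) ∂ν)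
    {lam : ℝ} (hlam0 : 0 < lam) (hlam1 : lam < 1)
    (hsub : ∀ g : Γ, ∃ n : ℤ, rfun B Kb g = lam ^ n) {x : ℝ} (hx0 : x ≠ 0)
    (hx : x ∈ ratioSet B ν Kb) : ∃ n : ℤ, x = lam ^ n := by
  have hxp : 0 < x := lt_of_le_of_ne hx.1 (Ne.symm hx0)
  refine lac_of_approx hlam0 hlam1 hxp fun ε hε => ?_
  obtain ⟨η, hη, hc⟩ := Metric.continuousAt_iff.1 (Real.continuousAt_log hx0) (ε/2) (half_pos hε)
  rcases H.dichotomy (exists_big ν hν hRN) with htriv | hd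
  · obtain ⟨g, hg⟩ := hx.2 η hη Set.univ MeasurableSet.univ (by simp)
    obtain ⟨ω, -, -, h⟩ := nonempty_of_measure_ne_zero hg.ne'
    have := hc (x := Kb g ω) (by rw [Real.dist_eq]; exact h)
    rw [htriv, Real.log_one, Real.dist_eq, zero_sub, abs_neg] at this
    exact ⟨0, by simpa using by linarith⟩
  · obtain ⟨M, hM⟩ := H.closing hd hlam0 hsub (half_pos hε)
    obtain ⟨A, hA, hνA, hA2⟩ := exists_piece H.hS H.hδ M hmB ν hν
    obtain ⟨g, hg⟩ := hx.2 η hη A hA hνA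
    obtain ⟨ω, h1, h2, h3⟩ := nonempty_of_measure_ne_zero hg.ne'
    obtain ⟨u, hu, rfl⟩ := B.cls_surj ω
    rw [B.smul_cls _ _ hu] at h2
    obtain ⟨n, a, b⟩ := hM g u hu (hA2 _ _ hu (hu.mul H.hS g⁻¹) h1 h2)
    have hk := H.Kb_pos g (B.cls u)
    have hl : 0 < lam ^ n := zpow_pos hlam0 n
    have a' := Real.log_le_log hk a
    have b' := Real.log_le_log hl b
    rw [Real.log_mul (Real.exp_pos _).ne' hl.ne', Real.log_exp, Real.log_zpow] at a'
    rw [Real.log_mul (Real.exp_pos _).ne' hk.ne', Real.log_exp, Real.log_zpow] at b'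
    have c := hc (x := Kb g (B.cls u)) (by rw [Real.dist_eq]; exact h3)
    rw [Real.dist_eq, abs_lt] at c
    refine ⟨n, abs_le.2 ⟨by linarith [c.1, c.2], by linarith [c.1, c.2]⟩⟩

end

theorem ratio_set_lacunary
    (Γ : Type) [Group Γ] (S : Set Γ) (δ : ℝ)
    (hS : IsGenSet S) (hδ : IsHyperbolic S δ) (hne : Nonelementary Γ)
    (μ : Γ → ℝ) (hμ : IsRWMeasure S μ)
    (B : Boundary Γ S)
    (Kb : Γ → B.pt → ℝ)
    (hKb : ∀ (x : Γ) (ξ : B.pt) (u : ℕ → Γ), ConvInf S u → B.cls u = ξ →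
      Tendsto (fun n => martinK μ x (u n)) atTop (𝓝 (Kb x ξ)))
    [mB : MeasurableSpace B.pt] (hmB : mB = @borel B.pt (btop B))
    (ν : Measure B.pt) (hν : IsProbabilityMeasure ν)
    (hstat : ∀ A : Set B.pt, MeasurableSet A →
      ν A = ∑' g : Γ, ENNReal.ofReal (μ g) * ν (B.smul g ⁻¹' A))
    (hRN : ∀ (g : Γ) (A : Set B.pt), MeasurableSet A →
      ν (B.smul g ⁻¹' A) = ∫⁻ ω in A, ENNReal.ofReal (Kb g ω) ∂ν)
    (lam : ℝ) (hlam0 : 0 < lam) (hlam1 : lam < 1)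
    (hsub : ∀ g : Γ, ∃ n : ℤ, rfun B Kb g = lam ^ n) :
    (∀ x ∈ ratioSet B ν Kb \ {0}, ∃ n : ℤ, x = lam ^ n) ∧
    (1 : ℝ) ∈ ratioSet B ν Kb \ {0} ∧
    (∀ x ∈ ratioSet B ν Kb \ {0}, ∀ y ∈ ratioSet B ν Kb \ {0},
      x * y ∈ ratioSet B ν Kb \ {0}) ∧
    (∀ x ∈ ratioSet B ν Kb \ {0}, x⁻¹ ∈ ratioSet B ν Kb \ {0}) := by
  have hfin := fin_of_RN hS hμ hKb ν hν hRN
  have H : Ctx S δ μ B Kb := ⟨hS, hδ, hne, hμ, hKb, hfin⟩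
  refine ⟨fun x hx => H.lac hmB ν hν hRN hlam0 hlam1 hsub hx.2 hx.1, ⟨H.one_mem ν, one_ne_zero⟩,
    fun x hx y hy => ⟨H.mul_mem hmB ν hx.1 hy.1, mul_ne_zero hx.2 hy.2⟩,
    fun x hx => ⟨H.inv_mem hmB ν hRN hx.2 hx.1, inv_ne_zero hx.2⟩⟩

end HarmonicBoundary
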